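/- arXiv:2507.21570 — 9 statements merged into one kernel-verified Lean document; each statement's English description precedes it below -/
import Mathlib

section
/- Optimality of the weighted likelihood-ratio threshold detector (optimality part of Theorem 1): Let γ > 0 and η ∈ [0,1], let δ* be the randomized threshold detector with these parameters, and suppose its false positive rate equals ε, i.e. ∑_{e∈E} w⁺_e ∫ δ*_e dP_e = ε. Then for every detector δ = (δ_e)_{e∈E} (a family of measurable functions δ_e : Ω → [0,1]) satisfying ∑_{e∈E} w⁺_e ∫ δ_e dP_e ≤ ε, one has ∑_{e∈E} w⁻_e ∫ (1−δ*_e) dQ_e ≤ ∑_{e∈E} w⁻_e ∫ (1−δ_e) dQ_e; that is, δ* minimizes the false negative rate among all detectors whose false positive rate is at most ε. -/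
open MeasureTheory

/-- If `φ - ψ` has the sign of `b - a * dP/dQ`, then passing from `ψ` to `φ` raises the weighted
mass `b * ∫ · ∂Q` by at least as much as `a * ∫ · ∂P`. -/
lemma mul_integral_sub_le_of_rnDeriv_threshold {Ω : Type*} [MeasurableSpace Ω]
    {P Q : Measure Ω} [IsFiniteMeasure P] [IsFiniteMeasure Q] (hPQ : P ≪ Q) {a b : ℝ}
    {φ ψ : Ω → ℝ} (hφP : Integrable φ P) (hψP : Integrable ψ P)
    (hφQ : Integrable φ Q) (hψQ : Integrable ψ Q)
    (h : ∀ x, 0 ≤ (φ x - ψ x) * (b - a * (P.rnDeriv Q x).toReal)) :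
    a * (∫ x, φ x ∂P - ∫ x, ψ x ∂P) ≤ b * (∫ x, φ x ∂Q - ∫ x, ψ x ∂Q) := by
  have hP : Integrable (fun x => (P.rnDeriv Q x).toReal • (φ x - ψ x)) Q :=
    (integrable_rnDeriv_smul_iff hPQ).2 (hφP.sub hψP)
  rw [← integral_sub hφP hψP, ← integral_sub hφQ hψQ, ← integral_rnDeriv_smul hPQ,
    ← integral_const_mul, ← integral_const_mul]
  refine integral_mono (hP.const_mul a) ((hφQ.sub hψQ).const_mul b) fun x => ?_
  have := h x
  simp only [smul_eq_mul]
  linarith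

/-- Optimality of the weighted likelihood-ratio threshold detector (Theorem 1, optimality part):
among all detectors whose false positive rate is at most `ε`, the randomized threshold detector
`δstar` (whose false positive rate equals `ε`) minimizes the false negative rate. -/
theorem threshold_detector_optimal
    {Ω : Type*} [MeasurableSpace Ω] {E : Type*} [Fintype E]
    (P Q : E → Measure Ω)
    [∀ e, IsProbabilityMeasure (P e)] [∀ e, IsProbabilityMeasure (Q e)]
    (hPQ : ∀ e, P e ≪ Q e)
    (f : E → Ω → ℝ)
    (hf : ∀ e x, f e x = ((P e).rnDeriv (Q e) x).toReal)
    (wp wm : E → ℝ)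
    (hwp : ∀ e, 0 < wp e) (hwm : ∀ e, 0 < wm e)
    (hwp1 : ∑ e, wp e = 1) (hwm1 : ∑ e, wm e = 1)
    (γ : ℝ) (hγ : 0 < γ) (η : ℝ) (hη : η ∈ Set.Icc (0 : ℝ) 1)
    (δstar : E → Ω → ℝ)
    (hδstar : ∀ e x, δstar e x =
      if f e x < (wm e / wp e) * γ then 1
      else if f e x = (wm e / wp e) * γ then 1 - η
      else 0)
    (ε : ℝ)
    (hε : ∑ e, wp e * ∫ x, δstar e x ∂(P e) = ε)
    (δ : E → Ω → ℝ)
    (hδmeas : ∀ e, Measurable (δ e))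
    (hδ01 : ∀ e x, δ e x ∈ Set.Icc (0 : ℝ) 1)
    (hfp : ∑ e, wp e * ∫ x, δ e x ∂(P e) ≤ ε) :
    ∑ e, wm e * ∫ x, (1 - δstar e x) ∂(Q e) ≤
      ∑ e, wm e * ∫ x, (1 - δ e x) ∂(Q e) := by
  have hfmeas : ∀ e, Measurable (f e) := fun e => by
    rw [funext (hf e)]
    exact (Measure.measurable_rnDeriv _ _).ennreal_toReal
  have hδsmeas : ∀ e, Measurable (δstar e) := fun e => by
    rw [funext (hδstar e)]
    exact Measurable.ite (measurableSet_lt (hfmeas e) measurable_const) measurable_const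
      (Measurable.ite (measurableSet_eq_fun (hfmeas e) measurable_const)
        measurable_const measurable_const)
  have hδs01 : ∀ e x, δstar e x ∈ Set.Icc (0 : ℝ) 1 := fun e x => by
    obtain ⟨h0, h1⟩ := hη
    rw [hδstar]
    split_ifs <;> constructor <;> linarith
  have hint : ∀ (μ : Measure Ω) [IsProbabilityMeasure μ] (g : Ω → ℝ), Measurable g →
      (∀ x, g x ∈ Set.Icc (0 : ℝ) 1) → Integrable g μ := fun μ _ g hg h01 =>
    Integrable.of_mem_Icc 0 1 hg.aemeasurable (ae_of_all _ h01)
  have hsign : ∀ e x,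
      0 ≤ (δstar e x - δ e x) * (wm e * γ - wp e * ((P e).rnDeriv (Q e) x).toReal) := by
    intro e x
    obtain ⟨h0, h1⟩ := hδ01 e x
    have hc : wm e * γ = wp e * (wm e / wp e * γ) := by
      have := (hwp e).ne'
      field_simp
    rw [← hf, hδstar, hc, ← mul_sub]
    split_ifs with hlt heq
    · exact mul_nonneg (by linarith) (mul_nonneg (hwp e).le (by linarith))
    · simp [heq]
    · exact mul_nonneg_of_nonpos_of_nonpos (by linarith)
        (mul_nonpos_of_nonneg_of_nonpos (hwp e).le (by linarith))
  have hsum := Finset.sum_le_sum fun e (_ : e ∈ Finset.univ) =>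
    mul_integral_sub_le_of_rnDeriv_threshold (hPQ e)
      (hint (P e) _ (hδsmeas e) (hδs01 e)) (hint (P e) _ (hδmeas e) (hδ01 e))
      (hint (Q e) _ (hδsmeas e) (hδs01 e)) (hint (Q e) _ (hδmeas e) (hδ01 e)) (hsign e)
  have hfn : ∀ g : E → Ω → ℝ, (∀ e, Integrable (g e) (Q e)) →
      ∑ e, wm e * ∫ x, (1 - g e x) ∂(Q e) = 1 - ∑ e, wm e * ∫ x, g e x ∂(Q e) := by
    intro g hg
    rw [← hwm1, ← Finset.sum_sub_distrib]
    refine Finset.sum_congr rfl fun e _ => ?_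
    rw [integral_sub (integrable_const _) (hg e)]
    simp [mul_sub, hwm1]
  rw [hfn _ fun e => hint (Q e) _ (hδsmeas e) (hδs01 e),
    hfn _ fun e => hint (Q e) _ (hδmeas e) (hδ01 e)]
  simp only [mul_right_comm _ γ, mul_sub, Finset.sum_sub_distrib, ← Finset.sum_mul] at hsum
  have hnonneg : 0 ≤ (∑ e, wm e * ∫ x, δstar e x ∂(Q e) - ∑ e, wm e * ∫ x, δ e x ∂(Q e)) * γ := by
    rw [sub_mul]
    linarith
  linarith [nonneg_of_mul_nonneg_left hnonneg hγ]
end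

section
/- Existence part of Theorem 1: For every ε ∈ (0,1) there exist γ ≥ 0 and η ∈ [0,1] such that the randomized threshold detector with parameters (γ, η) has false positive rate exactly ε; that is, ∑_{e∈E} w⁺_e [ P_e({x : f_e(x) < (w⁻_e/w⁺_e)γ}) + η · P_e({x : f_e(x) = (w⁻_e/w⁺_e)γ}) ] = ε. -/
open MeasureTheory

open Filter Topology in
/-- A randomized quantile: a probability measure on the real line has, for every level `ε ∈ (0,1)`,
a point `γ` such that a suitable fraction of the atom at `γ` completes the mass below `γ` to `ε`. -/
theorem exists_randomized_quantile (μ : Measure ℝ) [IsProbabilityMeasure μ]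
    {ε : ℝ} (hε : ε ∈ Set.Ioo (0 : ℝ) 1) :
    ∃ γ : ℝ, ∃ η ∈ Set.Icc (0 : ℝ) 1, μ.real (Set.Iio γ) + η * μ.real {γ} = ε := by
  set F := ProbabilityTheory.cdf μ with hF
  set S : Set ℝ := {x | ε ≤ F x} with hS
  have hne : S.Nonempty :=
    ((ProbabilityTheory.tendsto_cdf_atTop μ).eventually (eventually_ge_nhds hε.2)).exists
  have hbdd : BddBelow S := by
    obtain ⟨b, hb⟩ :=
      ((ProbabilityTheory.tendsto_cdf_atBot μ).eventually (eventually_lt_nhds hε.1)).exists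
    refine ⟨b, fun x hx => ?_⟩
    by_contra! h
    exact absurd (hx.trans (F.mono h.le)) (not_le.mpr hb)
  set γ := sInf S
  have hge : ε ≤ F γ := by
    have ht : Tendsto F (𝓝[>] γ) (𝓝 (F γ)) :=
      (F.right_continuous γ).tendsto.mono_left (nhdsWithin_mono _ Set.Ioi_subset_Ici_self)
    refine ge_of_tendsto ht ?_
    filter_upwards [self_mem_nhdsWithin] with y hy
    obtain ⟨s, hs, hsy⟩ := exists_lt_of_csInf_lt hne hy
    exact hs.trans (F.mono hsy.le)
  have hle : μ.real (Set.Iio γ) ≤ ε := by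
    have hlim : Function.leftLim F γ ≤ ε := by
      refine le_of_tendsto (F.mono.tendsto_leftLim γ) ?_
      filter_upwards [self_mem_nhdsWithin] with y hy
      by_contra! h
      exact absurd (csInf_le hbdd h.le) (not_le.mpr hy)
    rw [← ProbabilityTheory.measure_cdf μ, measureReal_def,
      StieltjesFunction.measure_Iio _ (ProbabilityTheory.tendsto_cdf_atBot μ), sub_zero]
    exact ENNReal.toReal_le_of_le_ofReal hε.1.le (ENNReal.ofReal_le_ofReal hlim)
  have hsplit : F γ = μ.real (Set.Iio γ) + μ.real {γ} := by
    rw [hF, ProbabilityTheory.cdf_eq_real, ← Set.Iio_union_right,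
      measureReal_union (by simp) (measurableSet_singleton γ)]
  rw [hsplit] at hge
  refine ⟨γ, ?_⟩
  rcases (measureReal_nonneg : 0 ≤ μ.real {γ}).eq_or_lt with h0 | hpos
  · exact ⟨0, by simp, by rw [← h0] at hge ⊢; linarith⟩
  · refine ⟨(ε - μ.real (Set.Iio γ)) / μ.real {γ}, ⟨?_, ?_⟩, ?_⟩
    · exact div_nonneg (by linarith) hpos.le
    · rw [div_le_one hpos]; linarith
    · field_simp; ring

/-- Existence part of Theorem 1: for every `ε ∈ (0,1)` there exist a threshold `γ ≥ 0` and a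
randomization parameter `η ∈ [0,1]` such that the randomized threshold detector with parameters
`(γ, η)` has false positive rate exactly `ε`. -/
theorem threshold_detector_exists
    {Ω : Type*} [MeasurableSpace Ω] {E : Type*} [Fintype E]
    (P Q : E → Measure Ω)
    [∀ e, IsProbabilityMeasure (P e)] [∀ e, IsProbabilityMeasure (Q e)]
    (hPQ : ∀ e, P e ≪ Q e)
    (f : E → Ω → ℝ)
    (hf : ∀ e x, f e x = ((P e).rnDeriv (Q e) x).toReal)
    (wp wm : E → ℝ)
    (hwp : ∀ e, 0 < wp e) (hwm : ∀ e, 0 < wm e)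
    (hwp1 : ∑ e, wp e = 1) (hwm1 : ∑ e, wm e = 1)
    (ε : ℝ) (hε : ε ∈ Set.Ioo (0 : ℝ) 1) :
    ∃ γ : ℝ, 0 ≤ γ ∧ ∃ η ∈ Set.Icc (0 : ℝ) 1,
      ∑ e, wp e *
        (((P e) {x | f e x < (wm e / wp e) * γ}).toReal +
          η * ((P e) {x | f e x = (wm e / wp e) * γ}).toReal) = ε := by
  have hfm : ∀ e, Measurable (fun x => f e x * (wp e / wm e)) := fun e => by
    simp only [hf]
    exact (Measure.measurable_rnDeriv _ _).ennreal_toReal.mul_const _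
  set μ : Measure ℝ :=
    ∑ e, ENNReal.ofReal (wp e) • (P e).map (fun x => f e x * (wp e / wm e)) with hμ
  have happly : ∀ s, MeasurableSet s →
      μ s = ∑ e, ENNReal.ofReal (wp e) * P e {x | f e x * (wp e / wm e) ∈ s} := fun s hs => by
    simp only [hμ, Measure.finsetSum_apply, Measure.smul_apply, smul_eq_mul]
    refine Finset.sum_congr rfl fun e _ => ?_
    rw [Measure.map_apply (hfm e) hs]
    rfl
  have hreal : ∀ s, MeasurableSet s →
      μ.real s = ∑ e, wp e * (P e {x | f e x * (wp e / wm e) ∈ s}).toReal := fun s hs => by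
    rw [measureReal_def, happly s hs, ENNReal.toReal_sum
      fun e _ => ENNReal.mul_ne_top ENNReal.ofReal_ne_top (measure_ne_top _ _)]
    simp only [ENNReal.toReal_mul, ENNReal.toReal_ofReal (hwp _).le]
  have : IsProbabilityMeasure μ := ⟨by
    rw [happly _ MeasurableSet.univ]
    simp [← ENNReal.ofReal_sum_of_nonneg fun e _ => (hwp e).le, hwp1]⟩
  obtain ⟨γ, η, hη, h⟩ := exists_randomized_quantile μ hε
  have hlt : ∀ e x, f e x * (wp e / wm e) < γ ↔ f e x < wm e / wp e * γ := fun e x => by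
    rw [← lt_div_iff₀ (div_pos (hwp e) (hwm e)), div_eq_mul_inv, inv_div, mul_comm γ]
  have heq : ∀ e x, f e x * (wp e / wm e) = γ ↔ f e x = wm e / wp e * γ := fun e x => by
    rw [← eq_div_iff (div_pos (hwp e) (hwm e)).ne', div_eq_mul_inv, inv_div, mul_comm γ]
  rw [hreal _ measurableSet_Iio, hreal _ (measurableSet_singleton γ)] at h
  simp only [Set.mem_Iio, Set.mem_singleton_iff, hlt, heq] at h
  refine ⟨γ, ?_, η, hη, ?_⟩
  · by_contra! hγ
    have hneg : ∀ e x, wm e / wp e * γ < f e x := fun e x =>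
      (mul_neg_of_pos_of_neg (div_pos (hwm e) (hwp e)) hγ).trans_le
        (hf e x ▸ ENNReal.toReal_nonneg)
    simp only [fun e x => (hneg e x).not_gt, fun e x => (hneg e x).ne', Set.ofPred_false,
      measure_empty, ENNReal.toReal_zero, mul_zero, Finset.sum_const_zero, add_zero] at h
    exact hε.1.ne h
  · rw [← h, Finset.mul_sum, ← Finset.sum_add_distrib]
    exact Finset.sum_congr rfl fun e _ => by ring
end

section
/- Proposition 1 (upper bound on the false negative rate of the optimal detector): Let δ* be the randomized threshold detector with parameters γ > 0 and η ∈ [0,1]. Then for every λ ∈ (0,1], the false negative rate satisfies ∑_{e∈E} w⁻_e ∫ (1−δ*_e) dQ_e ≤ ∑_{e∈E} (w⁻_e)^{1−λ} (w⁺_e)^{λ} γ^{−λ} ∫ f_e^{λ} dQ_e. (Since ∫ f_e^λ dQ_e = exp(−(1−λ) D_λ(P_e‖Q_e)) for the Rényi divergence D_λ, this is the Rényi-divergence upper bound of Proposition 1.) -/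
open MeasureTheory

/-- On a finite measure space, `g ^ p` with `p ∈ [0, 1]` is integrable when `g ≥ 0` is. -/
theorem integrable_rpow_of_le_one {Ω : Type*} [MeasurableSpace Ω] {μ : Measure Ω}
    [IsFiniteMeasure μ] {g : Ω → ℝ} (hg : Integrable g μ) (hg0 : ∀ x, 0 ≤ g x)
    {p : ℝ} (hp0 : 0 ≤ p) (hp1 : p ≤ 1) : Integrable (fun x => g x ^ p) μ := by
  refine ((integrable_const (1 : ℝ)).add hg).mono'
    (hg.aestronglyMeasurable.aemeasurable.pow_const p).aestronglyMeasurable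
    (Filter.Eventually.of_forall fun x => ?_)
  rw [Real.norm_of_nonneg (Real.rpow_nonneg (hg0 x) p), Pi.add_apply]
  rcases le_total (g x) 1 with h | h
  · linarith [Real.rpow_le_one (hg0 x) h hp0, hg0 x]
  · linarith [Real.rpow_le_self_of_one_le h hp1]

/-- A `[0, 1]`-valued function that vanishes where `g < t` has integral at most
`t ^ (-p) * ∫ g ^ p`. -/
theorem integral_le_rpow_neg_mul_integral_rpow {Ω : Type*} [MeasurableSpace Ω] {μ : Measure Ω}
    {g φ : Ω → ℝ} {p t : ℝ} (hg : Integrable (fun x => g x ^ p) μ) (hg0 : ∀ x, 0 ≤ g x)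
    (hp : 0 ≤ p) (ht : 0 < t) (hφ0 : ∀ x, 0 ≤ φ x) (hφ1 : ∀ x, φ x ≤ 1)
    (hφ : ∀ x, g x < t → φ x = 0) :
    ∫ x, φ x ∂μ ≤ t ^ (-p) * ∫ x, g x ^ p ∂μ := by
  rw [← integral_const_mul]
  refine integral_mono_of_nonneg (Filter.Eventually.of_forall hφ0) (hg.const_mul _)
    (Filter.Eventually.of_forall fun x => ?_)
  rcases lt_or_ge (g x) t with h | h
  · rw [hφ x h]
    exact mul_nonneg (Real.rpow_nonneg ht.le _) (Real.rpow_nonneg (hg0 x) _)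
  · calc φ x ≤ 1 := hφ1 x
      _ = t ^ (-p) * t ^ p := by rw [← Real.rpow_add ht, neg_add_cancel, Real.rpow_zero]
      _ ≤ t ^ (-p) * g x ^ p := by gcongr

/-- The weighted threshold constant: `b (b / a * c)^{-p} = b^{1-p} a^p c^{-p}`. -/
theorem mul_div_mul_rpow_neg {a b c : ℝ} (ha : 0 < a) (hb : 0 < b) (hc : 0 < c) (p : ℝ) :
    b * (b / a * c) ^ (-p) = b ^ (1 - p) * a ^ p * c ^ (-p) := by
  rw [Real.mul_rpow (div_pos hb ha).le hc.le, Real.div_rpow hb.le ha.le, Real.rpow_neg ha.le,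
    div_inv_eq_mul, sub_eq_add_neg, Real.rpow_add hb, Real.rpow_one]
  ring

/-- Proposition 1: Rényi-divergence upper bound on the false negative rate of the randomized
threshold detector. Since `∫ f_e^λ dQ_e = exp(−(1−λ) D_λ(P_e‖Q_e))`, the right-hand side is
`∑_e (w⁻_e)^{1−λ} (w⁺_e)^λ γ^{−λ} exp(−(1−λ) D_λ(P_e‖Q_e))`. -/
theorem false_negative_rate_upper_bound
    {Ω : Type*} [MeasurableSpace Ω] {E : Type*} [Fintype E]
    (P Q : E → Measure Ω)
    [∀ e, IsProbabilityMeasure (P e)] [∀ e, IsProbabilityMeasure (Q e)]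
    (hPQ : ∀ e, P e ≪ Q e)
    (f : E → Ω → ℝ)
    (hf : ∀ e x, f e x = ((P e).rnDeriv (Q e) x).toReal)
    (wp wm : E → ℝ)
    (hwp : ∀ e, 0 < wp e) (hwm : ∀ e, 0 < wm e)
    (hwp1 : ∑ e, wp e = 1) (hwm1 : ∑ e, wm e = 1)
    (γ : ℝ) (hγ : 0 < γ) (η : ℝ) (hη : η ∈ Set.Icc (0 : ℝ) 1)
    (δstar : E → Ω → ℝ)
    (hδstar : ∀ e x, δstar e x =
      if f e x < (wm e / wp e) * γ then 1
      else if f e x = (wm e / wp e) * γ then 1 - η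
      else 0)
    (lam : ℝ) (hlam : lam ∈ Set.Ioc (0 : ℝ) 1) :
    ∑ e, wm e * ∫ x, (1 - δstar e x) ∂(Q e) ≤
      ∑ e, wm e ^ (1 - lam) * wp e ^ lam * γ ^ (-lam) * ∫ x, f e x ^ lam ∂(Q e) := by
  refine Finset.sum_le_sum fun e _ => ?_
  have hf0 (x) : 0 ≤ f e x := by rw [hf]; exact ENNReal.toReal_nonneg
  have hfint : Integrable (f e) (Q e) := by
    rw [show f e = fun x => ((P e).rnDeriv (Q e) x).toReal from funext (hf e)]
    exact Measure.integrable_toReal_rnDeriv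
  have ht : 0 < wm e / wp e * γ := mul_pos (div_pos (hwm e) (hwp e)) hγ
  rw [← mul_div_mul_rpow_neg (hwp e) (hwm e) hγ, mul_assoc]
  refine mul_le_mul_of_nonneg_left ?_ (hwm e).le
  refine integral_le_rpow_neg_mul_integral_rpow
    (integrable_rpow_of_le_one hfint hf0 hlam.1.le hlam.2) hf0 hlam.1.le ht
    (fun x => ?_) (fun x => ?_) (fun x hx => ?_)
  · rw [hδstar]
    split_ifs <;> linarith [hη.1]
  · rw [hδstar]
    split_ifs <;> linarith [hη.2]
  · rw [hδstar, if_pos hx, sub_self]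
end

section
/- Intermediate converse inequality (inequality (lowerF) in the proof of Proposition 2): In the tilted setting with λ ∈ (0,1), for every measurable test δ : Ω → [0,1], ∫_{T_λ} (1−δ) h_λ dμ ≥ 1/2 − Z_λ^{−1} · exp(−(1−λ)(m_λ − √(2 v_λ))) · ∫ δ f dμ. -/
open MeasureTheory

/-- Weighted Chebyshev inequality: a probability density `h` gives mass at least `1 / 2` to every
measurable set which contains, up to the zero set of `h`, all points where `L` is within
`√(2v)` of its `h`-mean, where `v` is the variance of `L` under `h`. -/
theorem half_le_setIntegral_of_variance {Ω : Type*} [MeasurableSpace Ω] {μ : Measure Ω}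
    {h L : Ω → ℝ} {m v : ℝ} {T : Set Ω} (hT : MeasurableSet T)
    (h_nonneg : ∀ x, 0 ≤ h x) (h_int : Integrable h μ) (h_one : ∫ x, h x ∂μ = 1)
    (hm_int : Integrable (fun x => h x * L x) μ) (hm : m = ∫ x, h x * L x ∂μ)
    (hv_int : Integrable (fun x => h x * L x ^ 2) μ)
    (hv : v = (∫ x, h x * L x ^ 2 ∂μ) - m ^ 2)
    (h_off : ∀ x, x ∉ T → h x = 0 ∨ √(2 * v) < |L x - m|) :
    1 / 2 ≤ ∫ x in T, h x ∂μ := by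
  have hexp : (fun x => h x * (L x - m) ^ 2) =
      fun x => h x * L x ^ 2 - 2 * m * (h x * L x) + m ^ 2 * h x := by
    funext x; ring
  have hdiff_int : Integrable (fun x => h x * L x ^ 2 - 2 * m * (h x * L x)) μ :=
    hv_int.sub (hm_int.const_mul _)
  have hsq_int : Integrable (fun x => h x * (L x - m) ^ 2) μ := by
    rw [hexp]
    exact hdiff_int.add (h_int.const_mul _)
  have hsq : ∫ x, h x * (L x - m) ^ 2 ∂μ = v := by
    rw [hexp, integral_add hdiff_int (h_int.const_mul _),
      integral_sub hv_int (hm_int.const_mul _), integral_const_mul, integral_const_mul,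
      ← hm, h_one, hv]
    ring
  have hsq_nonneg : ∀ x, 0 ≤ h x * (L x - m) ^ 2 := fun x =>
    mul_nonneg (h_nonneg x) (sq_nonneg _)
  have hv_nonneg : 0 ≤ v := hsq ▸ integral_nonneg hsq_nonneg
  have hsplit : ∫ x in T, h x ∂μ + ∫ x in Tᶜ, h x ∂μ = 1 := by
    rw [integral_add_compl hT h_int, h_one]
  suffices ∫ x in Tᶜ, h x ∂μ ≤ 1 / 2 by linarith
  rcases hv_nonneg.eq_or_lt with hv0 | hv_pos
  · have hae : ∀ᵐ x ∂μ, h x * (L x - m) ^ 2 = 0 :=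
      (integral_eq_zero_iff_of_nonneg hsq_nonneg hsq_int).1 (hsq.trans hv0.symm)
    have hzero : ∫ x in Tᶜ, h x ∂μ = 0 := by
      refine setIntegral_eq_zero_of_ae_eq_zero ?_
      filter_upwards [hae] with x hx hxT
      rcases h_off x hxT with h0 | hlt
      · exact h0
      · have hpos : 0 < |L x - m| := (Real.sqrt_nonneg _).trans_lt hlt
        exact (mul_eq_zero.1 hx).resolve_right (pow_ne_zero 2 (abs_pos.1 hpos))
    rw [hzero]; norm_num
  · have hle : ∫ x in Tᶜ, 2 * v * h x ∂μ ≤ ∫ x in Tᶜ, h x * (L x - m) ^ 2 ∂μ := by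
      refine setIntegral_mono_on (h_int.const_mul _).integrableOn hsq_int.integrableOn
        hT.compl fun x hxT => ?_
      rcases h_off x hxT with h0 | hlt
      · simp [h0]
      · have hge : 2 * v ≤ (L x - m) ^ 2 := by
          rw [← sq_abs]
          exact (Real.sqrt_le_left (abs_nonneg _)).1 hlt.le
        rw [mul_comm]
        exact mul_le_mul_of_nonneg_left hge (h_nonneg x)
    have hle_v : ∫ x in Tᶜ, h x * (L x - m) ^ 2 ∂μ ≤ v :=
      hsq ▸ setIntegral_le_integral hsq_int (Filter.Eventually.of_forall hsq_nonneg)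
    rw [integral_const_mul] at hle
    nlinarith

/-- If `c ≤ log (a / b)` then the geometric mean `a ^ t * b ^ (1 - t)` is at most
`exp (-(1 - t) * c) * a`. -/
theorem rpow_mul_rpow_le_exp_mul {a b t c : ℝ} (ha : 0 < a) (hb : 0 < b) (ht : t ≤ 1)
    (hc : c ≤ Real.log (a / b)) :
    a ^ t * b ^ (1 - t) ≤ Real.exp (-(1 - t) * c) * a := by
  rw [Real.log_div ha.ne' hb.ne'] at hc
  nth_rewrite 2 [← Real.exp_log ha]
  rw [Real.rpow_def_of_pos ha, Real.rpow_def_of_pos hb, ← Real.exp_add, ← Real.exp_add,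
    Real.exp_le_exp]
  nlinarith

/-- Intermediate converse inequality (inequality (lowerF)): in the tilted setting with
`λ ∈ (0,1)`, every randomized test `δ : Ω → [0,1]` satisfies
`∫_{T} (1−δ) h dμ ≥ 1/2 − Z⁻¹ exp(−(1−λ)(m − √(2v))) ∫ δ f dμ`. -/
theorem tilted_typical_set_lower_bound
    {Ω : Type*} [MeasurableSpace Ω] (μ : Measure Ω) [SigmaFinite μ]
    (f g : Ω → ℝ)
    (hf_meas : Measurable f) (hg_meas : Measurable g)
    (hf_nonneg : ∀ x, 0 ≤ f x) (hg_nonneg : ∀ x, 0 ≤ g x)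
    (hf_int : Integrable f μ) (hg_int : Integrable g μ)
    (hf1 : ∫ x, f x ∂μ = 1) (hg1 : ∫ x, g x ∂μ = 1)
    (lam : ℝ) (hlam : lam ∈ Set.Ioo (0 : ℝ) 1)
    (Z : ℝ)
    (hZ_int : Integrable (fun x => f x ^ lam * g x ^ (1 - lam)) μ)
    (hZ : Z = ∫ x, f x ^ lam * g x ^ (1 - lam) ∂μ)
    (hZ_pos : 0 < Z)
    (h : Ω → ℝ) (hh : ∀ x, h x = f x ^ lam * g x ^ (1 - lam) / Z)
    (m : ℝ)
    (hm_int : Integrable (fun x => h x * Real.log (f x / g x)) μ)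
    (hm : m = ∫ x, h x * Real.log (f x / g x) ∂μ)
    (v : ℝ)
    (hv_int : Integrable (fun x => h x * Real.log (f x / g x) ^ 2) μ)
    (hv : v = (∫ x, h x * Real.log (f x / g x) ^ 2 ∂μ) - m ^ 2)
    (T : Set Ω)
    (hT : T = {x | 0 < f x ∧ 0 < g x ∧
      |Real.log (f x / g x) - m| ≤ Real.sqrt (2 * v)})
    (δ : Ω → ℝ) (hδmeas : Measurable δ) (hδ01 : ∀ x, δ x ∈ Set.Icc (0 : ℝ) 1) :
    1 / 2 - Z⁻¹ * Real.exp (-(1 - lam) * (m - Real.sqrt (2 * v))) * ∫ x, δ x * f x ∂μ ≤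
      ∫ x in T, (1 - δ x) * h x ∂μ := by
  have h_eq : h = fun x => f x ^ lam * g x ^ (1 - lam) / Z := funext hh
  have h_nonneg : ∀ x, 0 ≤ h x := fun x => by
    rw [hh]
    exact div_nonneg (mul_nonneg (Real.rpow_nonneg (hf_nonneg x) _)
      (Real.rpow_nonneg (hg_nonneg x) _)) hZ_pos.le
  have h_int : Integrable h μ := h_eq ▸ hZ_int.div_const Z
  have h_one : ∫ x, h x ∂μ = 1 := by
    rw [h_eq, integral_div, ← hZ, div_self hZ_pos.ne']
  have hT_meas : MeasurableSet T := by
    rw [hT]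
    exact (measurableSet_lt measurable_const hf_meas).inter
      ((measurableSet_lt measurable_const hg_meas).inter
        (measurableSet_le (((hf_meas.div hg_meas).log.sub_const m).abs) measurable_const))
  have h_half : 1 / 2 ≤ ∫ x in T, h x ∂μ := by
    refine half_le_setIntegral_of_variance hT_meas h_nonneg h_int h_one hm_int hm hv_int hv
      fun x hxT => ?_
    rcases (hf_nonneg x).eq_or_lt with hf0 | hf_pos
    · left
      rw [hh, ← hf0, Real.zero_rpow hlam.1.ne']
      simp
    rcases (hg_nonneg x).eq_or_lt with hg0 | hg_pos
    · left
      rw [hh, ← hg0, Real.zero_rpow (sub_pos.2 hlam.2).ne']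
      simp
    right
    by_contra! hle
    exact hxT (hT ▸ ⟨hf_pos, hg_pos, hle⟩)
  set C := Z⁻¹ * Real.exp (-(1 - lam) * (m - Real.sqrt (2 * v))) with hC
  have hC_nonneg : 0 ≤ C := mul_nonneg (inv_nonneg.2 hZ_pos.le) (Real.exp_pos _).le
  have h_le : ∀ x ∈ T, h x ≤ C * f x := by
    intro x hx
    rw [hT] at hx
    obtain ⟨hf_pos, hg_pos, habs⟩ := hx
    have hlog : m - Real.sqrt (2 * v) ≤ Real.log (f x / g x) := by
      linarith [(abs_le.1 habs).1]
    rw [hh, hC, div_eq_inv_mul, mul_assoc]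
    exact mul_le_mul_of_nonneg_left (rpow_mul_rpow_le_exp_mul hf_pos hg_pos hlam.2.le hlog)
      (inv_nonneg.2 hZ_pos.le)
  have hδ_bound : ∀ᵐ x ∂μ, ‖δ x‖ ≤ 1 := Filter.Eventually.of_forall fun x => by
    rw [Real.norm_of_nonneg (hδ01 x).1]
    exact (hδ01 x).2
  have hδf_int : Integrable (fun x => δ x * f x) μ :=
    hf_int.bdd_mul hδmeas.aestronglyMeasurable hδ_bound
  have hδh_int : Integrable (fun x => δ x * h x) μ :=
    h_int.bdd_mul hδmeas.aestronglyMeasurable hδ_bound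
  have hδh_le : ∫ x in T, δ x * h x ∂μ ≤ C * ∫ x, δ x * f x ∂μ :=
    calc ∫ x in T, δ x * h x ∂μ ≤ ∫ x in T, C * (δ x * f x) ∂μ := by
          refine setIntegral_mono_on hδh_int.integrableOn (hδf_int.const_mul _).integrableOn
            hT_meas fun x hx => ?_
          rw [mul_left_comm]
          exact mul_le_mul_of_nonneg_left (h_le x hx) (hδ01 x).1
      _ = C * ∫ x in T, δ x * f x ∂μ := integral_const_mul _ _
      _ ≤ C * ∫ x, δ x * f x ∂μ :=
          mul_le_mul_of_nonneg_left (setIntegral_le_integral hδf_int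
            (Filter.Eventually.of_forall fun x => mul_nonneg (hδ01 x).1 (hf_nonneg x))) hC_nonneg
  have hsplit : ∫ x in T, (1 - δ x) * h x ∂μ =
      ∫ x in T, h x ∂μ - ∫ x in T, δ x * h x ∂μ := by
    rw [← integral_sub h_int.integrableOn hδh_int.integrableOn]
    exact integral_congr_ae (Filter.Eventually.of_forall fun x => by ring)
  linarith
end

section
/- Per-edge strong converse (core inequality in the proof of Proposition 2): In the tilted setting with λ ∈ (0,1), for every measurable test δ : Ω → [0,1], the false negative probability satisfies ∫ (1−δ) g dμ ≥ (1/2) · Z_λ · exp(−λ(m_λ + √(2 v_λ))) − (∫ δ f dμ) · exp(−m_λ + (1−2λ)√(2 v_λ)). -/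
open MeasureTheory

/-- If the log-likelihood ratio at a point is within `s` of `m`, then the tilted likelihood,
rescaled by `exp (-l * (m + s))`, is at most both `b` and `a * exp (-m + (1 - 2 * l) * s)`. -/
theorem tilted_le_of_abs_log_sub_le {a b l m s : ℝ} (ha : 0 < a) (hb : 0 < b)
    (hl : l ∈ Set.Ioo (0 : ℝ) 1) (hs : |Real.log (a / b) - m| ≤ s) :
    a ^ l * b ^ (1 - l) * Real.exp (-l * (m + s)) ≤ b ∧
      a ^ l * b ^ (1 - l) * Real.exp (-l * (m + s)) ≤ a * Real.exp (-m + (1 - 2 * l) * s) := by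
  obtain ⟨hl0, hl1⟩ := hl
  rw [Real.log_div ha.ne' hb.ne', abs_le] at hs
  obtain ⟨hs1, hs2⟩ := hs
  rw [Real.rpow_def_of_pos ha, Real.rpow_def_of_pos hb, ← Real.exp_add, ← Real.exp_add]
  constructor
  · rw [← Real.le_log_iff_exp_le hb]
    nlinarith [mul_nonneg hl0.le (sub_nonneg.2 hs2)]
  · conv_rhs => rw [← Real.exp_log ha, ← Real.exp_add]
    rw [Real.exp_le_exp]
    nlinarith [mul_nonneg (sub_nonneg.2 hl1.le) (sub_nonneg.2 hs1)]

/-- Per-edge strong converse (core inequality in the proof of Proposition 2): in the tilted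
setting with `λ ∈ (0,1)`, every randomized test `δ : Ω → [0,1]` satisfies
`∫ (1−δ) g dμ ≥ (1/2) Z exp(−λ(m+√(2v))) − (∫ δ f dμ) exp(−m + (1−2λ)√(2v))`. -/
theorem per_edge_strong_converse
    {Ω : Type*} [MeasurableSpace Ω] (μ : Measure Ω) [SigmaFinite μ]
    (f g : Ω → ℝ)
    (hf_meas : Measurable f) (hg_meas : Measurable g)
    (hf_nonneg : ∀ x, 0 ≤ f x) (hg_nonneg : ∀ x, 0 ≤ g x)
    (hf_int : Integrable f μ) (hg_int : Integrable g μ)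
    (hf1 : ∫ x, f x ∂μ = 1) (hg1 : ∫ x, g x ∂μ = 1)
    (lam : ℝ) (hlam : lam ∈ Set.Ioo (0 : ℝ) 1)
    (Z : ℝ)
    (hZ_int : Integrable (fun x => f x ^ lam * g x ^ (1 - lam)) μ)
    (hZ : Z = ∫ x, f x ^ lam * g x ^ (1 - lam) ∂μ)
    (hZ_pos : 0 < Z)
    (h : Ω → ℝ) (hh : ∀ x, h x = f x ^ lam * g x ^ (1 - lam) / Z)
    (m : ℝ)
    (hm_int : Integrable (fun x => h x * Real.log (f x / g x)) μ)
    (hm : m = ∫ x, h x * Real.log (f x / g x) ∂μ)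
    (v : ℝ)
    (hv_int : Integrable (fun x => h x * Real.log (f x / g x) ^ 2) μ)
    (hv : v = (∫ x, h x * Real.log (f x / g x) ^ 2 ∂μ) - m ^ 2)
    (δ : Ω → ℝ) (hδmeas : Measurable δ) (hδ01 : ∀ x, δ x ∈ Set.Icc (0 : ℝ) 1) :
    1 / 2 * Z * Real.exp (-lam * (m + Real.sqrt (2 * v))) -
        (∫ x, δ x * f x ∂μ) * Real.exp (-m + (1 - 2 * lam) * Real.sqrt (2 * v)) ≤
      ∫ x, (1 - δ x) * g x ∂μ := by
  have hl0 := hlam.1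
  have hl1 := hlam.2
  have h_nonneg : ∀ x, 0 ≤ h x := fun x => by
    rw [hh]
    exact div_nonneg (mul_nonneg (Real.rpow_nonneg (hf_nonneg x) _)
      (Real.rpow_nonneg (hg_nonneg x) _)) hZ_pos.le
  have h_eq : h = fun x => f x ^ lam * g x ^ (1 - lam) / Z := funext hh
  have h_int : Integrable h μ := by
    rw [h_eq]
    exact hZ_int.div_const Z
  have h_one : ∫ x, h x ∂μ = 1 := by
    rw [h_eq, integral_div, ← hZ, div_self hZ_pos.ne']
  have sq_eq : (fun x => h x * (Real.log (f x / g x) - m) ^ 2) = fun x =>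
      h x * Real.log (f x / g x) ^ 2 - 2 * m * (h x * Real.log (f x / g x)) + m ^ 2 * h x := by
    funext x
    ring
  have sq_int : Integrable (fun x => h x * (Real.log (f x / g x) - m) ^ 2) μ := by
    rw [sq_eq]
    exact (hv_int.sub (hm_int.const_mul _)).add (h_int.const_mul _)
  have sq_integral : ∫ x, h x * (Real.log (f x / g x) - m) ^ 2 ∂μ = v := by
    have diff_int : Integrable (fun x =>
        h x * Real.log (f x / g x) ^ 2 - 2 * m * (h x * Real.log (f x / g x))) μ :=
      hv_int.sub (hm_int.const_mul _)
    rw [sq_eq, integral_add diff_int (h_int.const_mul _), integral_sub hv_int (hm_int.const_mul _), integral_const_mul, integral_const_mul, h_one,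
      ← hm, hv]
    ring
  have sq_nonneg' : ∀ x, 0 ≤ h x * (Real.log (f x / g x) - m) ^ 2 := fun x =>
    mul_nonneg (h_nonneg x) (sq_nonneg _)
  have v_nonneg : 0 ≤ v := sq_integral ▸ integral_nonneg sq_nonneg'
  set s := Real.sqrt (2 * v)
  have s_sq : s ^ 2 = 2 * v := Real.sq_sqrt (by linarith)
  set c := Real.exp (-lam * (m + s)) with hc
  set K := Real.exp (-m + (1 - 2 * lam) * s) with hK
  have hc_pos : 0 < c := Real.exp_pos _
  have hK_pos : 0 < K := Real.exp_pos _
  have one_sub_int : Integrable (fun x => (1 - δ x) * g x) μ := by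
    refine hg_int.bdd_mul (c := 1) (by fun_prop) (ae_of_all _ fun x => ?_)
    rw [Real.norm_eq_abs, abs_le]
    constructor <;> linarith [(hδ01 x).1, (hδ01 x).2]
  have test_int : Integrable (fun x => δ x * f x) μ := by
    refine hf_int.bdd_mul (c := 1) (by fun_prop) (ae_of_all _ fun x => ?_)
    rw [Real.norm_eq_abs, abs_le]
    constructor <;> linarith [(hδ01 x).1, (hδ01 x).2]
  have concentrated : ∀ᵐ x ∂μ, 0 < v ∨ h x * (Real.log (f x / g x) - m) ^ 2 = 0 := by
    rcases v_nonneg.lt_or_eq with hv0 | hv0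
    · exact ae_of_all _ fun x => Or.inl hv0
    · rw [← hv0] at sq_integral
      filter_upwards [(integral_eq_zero_iff_of_nonneg sq_nonneg' sq_int).1 sq_integral] with x hx
      exact Or.inr hx
  have pointwise : ∀ᵐ x ∂μ,
      Z * c * (h x - h x * (Real.log (f x / g x) - m) ^ 2 / (2 * v)) ≤
        (1 - δ x) * g x + K * (δ x * f x) := by
    filter_upwards [concentrated] with x hx
    obtain ⟨hδ0, hδ1⟩ := hδ01 x
    have rhs_nonneg : 0 ≤ (1 - δ x) * g x + K * (δ x * f x) :=
      add_nonneg (mul_nonneg (sub_nonneg.2 hδ1) (hg_nonneg x))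
        (mul_nonneg hK_pos.le (mul_nonneg hδ0 (hf_nonneg x)))
    rcases (h_nonneg x).eq_or_lt with hx0 | hx0
    · simpa [← hx0] using rhs_nonneg
    by_cases hA : |Real.log (f x / g x) - m| ≤ s
    · have hf_pos : 0 < f x := (hf_nonneg x).lt_of_ne' fun h0 => by
        simp [hh, h0, Real.zero_rpow hl0.ne'] at hx0
      have hg_pos : 0 < g x := (hg_nonneg x).lt_of_ne' fun h0 => by
        simp [hh, h0, Real.zero_rpow (sub_pos.2 hl1).ne'] at hx0
      obtain ⟨h1, h2⟩ := tilted_le_of_abs_log_sub_le hf_pos hg_pos hlam hA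
      have hZh : f x ^ lam * g x ^ (1 - lam) = Z * h x := by
        rw [hh, mul_div_cancel₀ _ hZ_pos.ne']
      rw [hZh, ← hc] at h1 h2
      rw [← hK] at h2
      have hdrop : Z * c * (h x - h x * (Real.log (f x / g x) - m) ^ 2 / (2 * v)) ≤
          Z * h x * c := by
        have := mul_nonneg (mul_pos hZ_pos hc_pos).le
          (div_nonneg (sq_nonneg' x) (by linarith : 0 ≤ 2 * v))
        linarith
      have h3 := mul_le_mul_of_nonneg_left h1 (sub_nonneg.2 hδ1)
      have h4 := mul_le_mul_of_nonneg_left h2 hδ0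
      linarith
    · have hlt : s ^ 2 < (Real.log (f x / g x) - m) ^ 2 :=
        sq_lt_sq.2 ((abs_of_nonneg (Real.sqrt_nonneg _)).trans_lt (not_le.1 hA))
      rw [s_sq] at hlt
      have hv0 : 0 < v := hx.resolve_right (mul_pos hx0 (by linarith)).ne'
      refine le_trans (mul_nonpos_of_nonneg_of_nonpos (mul_pos hZ_pos hc_pos).le ?_) rhs_nonneg
      rw [sub_nonpos, le_div_iff₀ (by linarith)]
      exact mul_le_mul_of_nonneg_left hlt.le hx0.le
  have key := integral_mono_ae ((h_int.sub (sq_int.div_const (2 * v))).const_mul (Z * c))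
    (one_sub_int.add (test_int.const_mul K)) pointwise
  simp only [Pi.sub_apply, Pi.add_apply] at key
  rw [integral_const_mul, integral_sub h_int (sq_int.div_const (2 * v)), integral_div,
    sq_integral, h_one, integral_add one_sub_int (test_int.const_mul K), integral_const_mul] at key
  have half : v / (2 * v) ≤ 1 / 2 := by
    rcases v_nonneg.eq_or_lt with hv0 | hv0
    · simp [← hv0]
    · rw [div_le_iff₀ (by linarith)]
      linarith
  have := mul_le_mul_of_nonneg_left half (mul_pos hZ_pos hc_pos).le
  linarith
end

section
/- Proposition 2 (converse bound for Neyman–Pearson causal discovery): Let λ ∈ (0,1) and for each e ∈ E suppose the tilted quantities Z_{λ,e} ∈ (0,∞), m_{λ,e} and v_{λ,e} of the pair (P_e, Q_e) are finite. Then every detector δ = (δ_e)_{e∈E} whose false positive rate satisfies ∑_{e} w⁺_e ∫ δ_e dP_e ≤ ε has false negative rate bounded below as: ∑_{e} w⁻_e ∫ (1−δ_e) dQ_e ≥ (1/2) ∑_{e} w⁻_e · Z_{λ,e} · exp(−λ(m_{λ,e} + √(2 v_{λ,e}))) − ε · max_{e} [ (w⁻_e / w⁺_e) · exp(−m_{λ,e}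 + (1−2λ)√(2 v_{λ,e})) ]. -/
open MeasureTheory

/-- If the log-likelihood ratio `log (a / b)` lies in `[m - s, m + s]`, the randomized test value
`d` has weighted error at least `exp (-l (m + s)) * a ^ l * b ^ (1 - l)`. -/
lemma tilted_density_le_weighted_error {a b d l m s : ℝ} (ha : 0 < a) (hb : 0 < b)
    (hd : d ∈ Set.Icc (0 : ℝ) 1) (hl : l ∈ Set.Ioo (0 : ℝ) 1) (hL : |Real.log (a / b) - m| ≤ s) :
    Real.exp (-l * (m + s)) * (a ^ l * b ^ (1 - l)) ≤
      (1 - d) * b + Real.exp (-m + (1 - 2 * l) * s) * (d * a) := by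
  obtain ⟨hL1, hL2⟩ := abs_le.1 hL
  rw [Real.log_div ha.ne' hb.ne'] at hL1 hL2
  have hl0 := hl.1
  have hl1 := hl.2
  have hprod : Real.exp (-l * (m + s)) * (a ^ l * b ^ (1 - l)) =
      Real.exp (-l * (m + s) + (Real.log a * l + Real.log b * (1 - l))) := by
    rw [Real.rpow_def_of_pos ha, Real.rpow_def_of_pos hb, Real.exp_add, Real.exp_add]
  have h1 : Real.exp (-l * (m + s)) * (a ^ l * b ^ (1 - l)) ≤ b := by
    rw [hprod]
    conv_rhs => rw [← Real.exp_log hb]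
    apply Real.exp_le_exp.2
    nlinarith
  have h2 : Real.exp (-l * (m + s)) * (a ^ l * b ^ (1 - l)) ≤
      Real.exp (-m + (1 - 2 * l) * s) * a := by
    rw [hprod]
    conv_rhs => rw [← Real.exp_log ha, ← Real.exp_add]
    apply Real.exp_le_exp.2
    nlinarith
  nlinarith [mul_le_mul_of_nonneg_left h1 (sub_nonneg.2 hd.2),
    mul_le_mul_of_nonneg_left h2 hd.1]

/-- Converse bound for a randomized test between a single pair of densities `f` and `g`. -/
lemma half_tilted_bound_le_weighted_error {Ω : Type*} [MeasurableSpace Ω] {μ : Measure Ω}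
    {f g : Ω → ℝ} (hf_nonneg : ∀ x, 0 ≤ f x) (hg_nonneg : ∀ x, 0 ≤ g x)
    (hf_int : Integrable f μ) (hg_int : Integrable g μ)
    {l : ℝ} (hl : l ∈ Set.Ioo (0 : ℝ) 1) {Z : ℝ}
    (hZ_int : Integrable (fun x => f x ^ l * g x ^ (1 - l)) μ)
    (hZ : Z = ∫ x, f x ^ l * g x ^ (1 - l) ∂μ) (hZ_pos : 0 < Z)
    {h : Ω → ℝ} (hh : ∀ x, h x = f x ^ l * g x ^ (1 - l) / Z)
    {m : ℝ} (hm_int : Integrable (fun x => h x * Real.log (f x / g x)) μ)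
    (hm : m = ∫ x, h x * Real.log (f x / g x) ∂μ)
    {v : ℝ} (hv_int : Integrable (fun x => h x * Real.log (f x / g x) ^ 2) μ)
    (hv : v = (∫ x, h x * Real.log (f x / g x) ^ 2 ∂μ) - m ^ 2)
    {δ : Ω → ℝ} (hδmeas : Measurable δ) (hδ01 : ∀ x, δ x ∈ Set.Icc (0 : ℝ) 1) :
    (1 / 2) * (Z * Real.exp (-l * (m + Real.sqrt (2 * v)))) ≤
      (∫ x, (1 - δ x) * g x ∂μ) +
        Real.exp (-m + (1 - 2 * l) * Real.sqrt (2 * v)) * ∫ x, δ x * f x ∂μ := by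
  have hh_nonneg : ∀ x, 0 ≤ h x := fun x => by
    rw [hh]
    exact div_nonneg (mul_nonneg (Real.rpow_nonneg (hf_nonneg x) _)
      (Real.rpow_nonneg (hg_nonneg x) _)) hZ_pos.le
  have hh_int : Integrable h μ := by
    rw [funext hh]
    exact hZ_int.div_const Z
  have hh1 : ∫ x, h x ∂μ = 1 := by
    simp_rw [hh]
    rw [integral_div, ← hZ, div_self hZ_pos.ne']
  have hsq_eq : (fun x => h x * (Real.log (f x / g x) - m) ^ 2) = fun x =>
      h x * Real.log (f x / g x) ^ 2 - 2 * m * (h x * Real.log (f x / g x)) + m ^ 2 * h x := by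
    ext x
    ring
  have hdiff_int : Integrable (fun x =>
      h x * Real.log (f x / g x) ^ 2 - 2 * m * (h x * Real.log (f x / g x))) μ :=
    hv_int.sub (hm_int.const_mul _)
  have hsq_int : Integrable (fun x => h x * (Real.log (f x / g x) - m) ^ 2) μ := by
    rw [hsq_eq]
    exact hdiff_int.add (hh_int.const_mul _)
  have hsq : ∫ x, h x * (Real.log (f x / g x) - m) ^ 2 ∂μ = v := by
    rw [hsq_eq, integral_add hdiff_int (hh_int.const_mul _),
      integral_sub hv_int (hm_int.const_mul _), integral_const_mul, integral_const_mul,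
      ← hm, hh1, hv]
    ring
  have hsq_nonneg : ∀ x, 0 ≤ h x * (Real.log (f x / g x) - m) ^ 2 := fun x =>
    mul_nonneg (hh_nonneg x) (sq_nonneg _)
  have hv_nonneg : 0 ≤ v := hsq ▸ integral_nonneg hsq_nonneg
  have hzero : ∀ᵐ x ∂μ, v = 0 → h x * (Real.log (f x / g x) - m) ^ 2 = 0 := by
    by_cases hv0 : v = 0
    · rw [hv0, integral_eq_zero_iff_of_nonneg hsq_nonneg hsq_int] at hsq
      filter_upwards [hsq] with x hx _ using hx
    · exact Filter.Eventually.of_forall fun x hx => absurd hx hv0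
  have hδf : Integrable (fun x => δ x * f x) μ :=
    hf_int.bdd_mul (c := 1) hδmeas.aestronglyMeasurable (Filter.Eventually.of_forall fun x => by
      rw [Real.norm_eq_abs, abs_of_nonneg (hδ01 x).1]
      exact (hδ01 x).2)
  have hδg : Integrable (fun x => (1 - δ x) * g x) μ :=
    hg_int.bdd_mul (c := 1) (measurable_const.sub hδmeas).aestronglyMeasurable
      (Filter.Eventually.of_forall fun x => by
        rw [Real.norm_eq_abs, abs_of_nonneg (sub_nonneg.2 (hδ01 x).2)]
        linarith [(hδ01 x).1])
  set C := Z * Real.exp (-l * (m + Real.sqrt (2 * v))) with hC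
  set K := Real.exp (-m + (1 - 2 * l) * Real.sqrt (2 * v)) with hK
  have hC_pos : 0 < C := mul_pos hZ_pos (Real.exp_pos _)
  have hpt : ∀ᵐ x ∂μ, C * (h x - h x * (Real.log (f x / g x) - m) ^ 2 / (2 * v)) ≤
      (1 - δ x) * g x + K * (δ x * f x) := by
    filter_upwards [hzero] with x hx
    have hrhs : 0 ≤ (1 - δ x) * g x + K * (δ x * f x) :=
      add_nonneg (mul_nonneg (sub_nonneg.2 (hδ01 x).2) (hg_nonneg x))
        (mul_nonneg (Real.exp_pos _).le (mul_nonneg (hδ01 x).1 (hf_nonneg x)))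
    rcases (hh_nonneg x).eq_or_lt with h0 | hpos
    · rw [← h0]
      simpa using hrhs
    · have hf_pos : 0 < f x := (hf_nonneg x).lt_of_ne fun hf0 => by
        rw [hh, ← hf0, Real.zero_rpow hl.1.ne'] at hpos
        simp at hpos
      have hg_pos : 0 < g x := (hg_nonneg x).lt_of_ne fun hg0 => by
        rw [hh, ← hg0, Real.zero_rpow (sub_pos.2 hl.2).ne'] at hpos
        simp at hpos
      by_cases hL : (Real.log (f x / g x) - m) ^ 2 ≤ 2 * v
      · have hkey := tilted_density_le_weighted_error hf_pos hg_pos (hδ01 x) hl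
          (Real.abs_le_sqrt hL)
        have hCh : C * h x =
            Real.exp (-l * (m + Real.sqrt (2 * v))) * (f x ^ l * g x ^ (1 - l)) := by
          rw [hC, hh]
          field_simp
        have hdrop : 0 ≤ C * (h x * (Real.log (f x / g x) - m) ^ 2 / (2 * v)) :=
          mul_nonneg hC_pos.le (div_nonneg (hsq_nonneg x) (by positivity))
        rw [mul_sub, hCh]
        linarith
      · push Not at hL
        have hv_pos : 0 < v := hv_nonneg.lt_of_ne fun hv0 => by
          rcases mul_eq_zero.1 (hx hv0.symm) with h' | h'
          · exact hpos.ne' h'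
          · linarith
        refine le_trans (mul_nonpos_of_nonneg_of_nonpos hC_pos.le ?_) hrhs
        rw [sub_nonpos, le_div_iff₀ (by positivity)]
        exact mul_le_mul_of_nonneg_left hL.le hpos.le
  have hint := integral_mono_ae ((hh_int.sub (hsq_int.div_const (2 * v))).const_mul C)
    (hδg.add (hδf.const_mul K)) hpt
  simp only [Pi.sub_apply, Pi.add_apply] at hint
  rw [integral_const_mul, integral_sub hh_int (hsq_int.div_const _), integral_div, hsq, hh1,
    integral_add hδg (hδf.const_mul K), integral_const_mul] at hint
  refine le_trans ?_ hint
  have hhalf : v / (2 * v) ≤ 1 / 2 := by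
    rcases hv_nonneg.eq_or_lt with hv0 | hv_pos
    · rw [← hv0]
      norm_num
    · exact le_of_eq (by field_simp)
  nlinarith

/-- Proposition 2 (converse bound for Neyman–Pearson causal discovery): every detector whose
false positive rate is at most `ε` has false negative rate at least
`(1/2) ∑_e w⁻_e Z_e exp(−λ(m_e+√(2v_e))) − ε max_e (w⁻_e/w⁺_e) exp(−m_e+(1−2λ)√(2v_e))`,
where `Z_e, m_e, v_e` are the tilted quantities of the pair `(P_e, Q_e)` with densities
`f_e, g_e` with respect to `μ_e`. -/
theorem neyman_pearson_causal_discovery_converse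
    {Ω : Type*} [MeasurableSpace Ω] {E : Type*} [Fintype E] [Nonempty E]
    (μ : E → Measure Ω) [∀ e, SigmaFinite (μ e)]
    (f g : E → Ω → ℝ)
    (hf_meas : ∀ e, Measurable (f e)) (hg_meas : ∀ e, Measurable (g e))
    (hf_nonneg : ∀ e x, 0 ≤ f e x) (hg_nonneg : ∀ e x, 0 ≤ g e x)
    (hf_int : ∀ e, Integrable (f e) (μ e)) (hg_int : ∀ e, Integrable (g e) (μ e))
    (hf1 : ∀ e, ∫ x, f e x ∂(μ e) = 1) (hg1 : ∀ e, ∫ x, g e x ∂(μ e) = 1)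
    (wp wm : E → ℝ)
    (hwp : ∀ e, 0 < wp e) (hwm : ∀ e, 0 < wm e)
    (hwp1 : ∑ e, wp e = 1) (hwm1 : ∑ e, wm e = 1)
    (lam : ℝ) (hlam : lam ∈ Set.Ioo (0 : ℝ) 1)
    (Z : E → ℝ)
    (hZ_int : ∀ e, Integrable (fun x => f e x ^ lam * g e x ^ (1 - lam)) (μ e))
    (hZ : ∀ e, Z e = ∫ x, f e x ^ lam * g e x ^ (1 - lam) ∂(μ e))
    (hZ_pos : ∀ e, 0 < Z e)
    (h : E → Ω → ℝ) (hh : ∀ e x, h e x = f e x ^ lam * g e x ^ (1 - lam) / Z e)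
    (m : E → ℝ)
    (hm_int : ∀ e, Integrable (fun x => h e x * Real.log (f e x / g e x)) (μ e))
    (hm : ∀ e, m e = ∫ x, h e x * Real.log (f e x / g e x) ∂(μ e))
    (v : E → ℝ)
    (hv_int : ∀ e, Integrable (fun x => h e x * Real.log (f e x / g e x) ^ 2) (μ e))
    (hv : ∀ e, v e = (∫ x, h e x * Real.log (f e x / g e x) ^ 2 ∂(μ e)) - m e ^ 2)
    (ε : ℝ)
    (δ : E → Ω → ℝ)
    (hδmeas : ∀ e, Measurable (δ e))
    (hδ01 : ∀ e x, δ e x ∈ Set.Icc (0 : ℝ) 1)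
    (hfp : ∑ e, wp e * ∫ x, δ e x * f e x ∂(μ e) ≤ ε) :
    (1 / 2) * ∑ e, wm e * Z e * Real.exp (-lam * (m e + Real.sqrt (2 * v e))) -
        ε * (Finset.univ.sup' Finset.univ_nonempty fun e =>
          (wm e / wp e) * Real.exp (-(m e) + (1 - 2 * lam) * Real.sqrt (2 * v e))) ≤
      ∑ e, wm e * ∫ x, (1 - δ e x) * g e x ∂(μ e) := by
  have hbound : ∀ e, (1 / 2) * (Z e * Real.exp (-lam * (m e + Real.sqrt (2 * v e)))) ≤
      (∫ x, (1 - δ e x) * g e x ∂(μ e)) +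
        Real.exp (-(m e) + (1 - 2 * lam) * Real.sqrt (2 * v e)) * ∫ x, δ e x * f e x ∂(μ e) :=
    fun e => half_tilted_bound_le_weighted_error (hf_nonneg e) (hg_nonneg e) (hf_int e) (hg_int e)
      hlam (hZ_int e) (hZ e) (hZ_pos e) (hh e) (hm_int e) (hm e) (hv_int e) (hv e) (hδmeas e)
      (hδ01 e)
  set F : E → ℝ := fun e =>
    (wm e / wp e) * Real.exp (-(m e) + (1 - 2 * lam) * Real.sqrt (2 * v e)) with hF
  set M := Finset.univ.sup' Finset.univ_nonempty F
  have hFM : ∀ e, F e ≤ M := fun e => Finset.le_sup' F (Finset.mem_univ e)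
  have hM : 0 ≤ M :=
    le_trans (mul_nonneg (div_nonneg (hwm _).le (hwp _).le) (Real.exp_pos _).le)
      (hFM (Classical.arbitrary E))
  have hterm : ∀ e, (1 / 2) * (wm e * Z e * Real.exp (-lam * (m e + Real.sqrt (2 * v e)))) ≤
      wm e * (∫ x, (1 - δ e x) * g e x ∂(μ e)) + M * (wp e * ∫ x, δ e x * f e x ∂(μ e)) := by
    intro e
    have hI : 0 ≤ wp e * ∫ x, δ e x * f e x ∂(μ e) :=
      mul_nonneg (hwp e).le
        (integral_nonneg fun x => mul_nonneg (hδ01 e x).1 (hf_nonneg e x))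
    have hFe : wm e * (Real.exp (-(m e) + (1 - 2 * lam) * Real.sqrt (2 * v e)) *
        ∫ x, δ e x * f e x ∂(μ e)) = F e * (wp e * ∫ x, δ e x * f e x ∂(μ e)) := by
      have := (hwp e).ne'
      simp only [hF]
      field_simp
    have h1 := mul_le_mul_of_nonneg_left (hbound e) (hwm e).le
    have h2 := mul_le_mul_of_nonneg_right (hFM e) hI
    rw [mul_add (wm e), hFe] at h1
    linarith
  have hsum := Finset.sum_le_sum fun e (_ : e ∈ Finset.univ) => hterm e
  rw [← Finset.mul_sum, Finset.sum_add_distrib, ← Finset.mul_sum] at hsum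
  have hεM := mul_le_mul_of_nonneg_left hfp hM
  linarith
end

section
/- Lemma 1 (chi-squared law of the residual sum of squares): Let n, p ∈ ℕ with 1 ≤ p < n, let X be a real n×p design matrix with XᵀX invertible, let α ∈ ℝ^p and σ > 0. Let W = (W_1, …, W_n) be distributed according to the n-fold product of the Gaussian measure on ℝ with mean 0 and variance σ², and set Y = Xα + W, α̂ = (XᵀX)⁻¹XᵀY, and RSS = ‖Y − X α̂‖² = ∑_{k=1}^n (Y_k − (X α̂)_k)². Then the law of RSS/σ² (the pushforward of the product Gaussian measure under w ↦ RSS(X α + w)/σ²) is the chi-squared distribution with n−p degrees of freedom, i.e. the Gamma distribution with shape (n−p)/2 and rate 1/2. -/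
open MeasureTheory Matrix ProbabilityTheory

namespace ProbabilityTheory

open scoped Topology

/-- The moment generating function of the Gamma distribution, on the real line. -/
lemma complexMGF_gammaMeasure_ofReal {a r s : ℝ} (ha : 0 < a) (hr : 0 < r) (hs : s < r) :
    complexMGF id (gammaMeasure a r) s = (r : ℂ) ^ (a : ℂ) * (1 / (r - s)) ^ (a : ℂ) := by
  rw [complexMGF, gammaMeasure, integral_withDensity_eq_integral_toReal_smul (f := gammaPDF a r)
      (measurable_gammaPDFReal a r).ennreal_ofReal (by simp [gammaPDF])]
  have h : ∀ x : ℝ, (gammaPDF a r x).toReal • Complex.exp (s * (id x : ℝ)) =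
      (Set.Ici (0 : ℝ)).indicator (fun x : ℝ ↦ ((r : ℂ) ^ (a : ℂ) / Complex.Gamma a) *
        ((x : ℂ) ^ ((a : ℂ) - 1) * Complex.exp (-((r - s : ℝ) * x)))) x := by
    intro x
    rw [gammaPDF, ENNReal.toReal_ofReal (gammaPDFReal_nonneg ha hr x), gammaPDFReal]
    by_cases hx : 0 ≤ x
    · rw [Set.indicator_of_mem (by exact hx), if_pos hx, Complex.real_smul]
      push_cast [Complex.ofReal_cpow hr.le, Complex.ofReal_cpow hx, Complex.Gamma_ofReal]
      rw [mul_assoc, mul_assoc, ← Complex.exp_add, id_eq]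
      ring_nf
    · rw [Set.indicator_of_notMem (by exact hx), if_neg hx, zero_smul]
  simp_rw [h]
  rw [integral_indicator measurableSet_Ici, integral_Ici_eq_integral_Ioi, integral_const_mul,
    Complex.integral_cpow_mul_exp_neg_mul_Ioi (by simpa) (sub_pos.2 hs), Complex.ofReal_sub]
  have : Complex.Gamma a ≠ 0 := by
    rw [Complex.Gamma_ofReal]; exact_mod_cast (Real.Gamma_pos_of_pos ha).ne'
  field_simp

/-- The Gamma distribution with rate `r` has exponential moments of every order below `r`. -/
lemma Iio_subset_integrableExpSet_gammaMeasure {a r : ℝ} (ha : 0 < a) (hr : 0 < r) :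
    Set.Iio r ⊆ integrableExpSet id (gammaMeasure a r) := by
  intro s hs
  rw [integrableExpSet, Set.mem_ofPred_eq]
  by_contra hint
  have h0 := complexMGF_undef (X := id) (z := (s : ℂ)) aemeasurable_id hint
  rw [complexMGF_gammaMeasure_ofReal ha hr hs, ← Complex.ofReal_sub, ← Complex.ofReal_one,
    ← Complex.ofReal_div, ← Complex.ofReal_cpow hr.le,
    ← Complex.ofReal_cpow (one_div_nonneg.2 (sub_pos.2 hs).le), ← Complex.ofReal_mul] at h0
  have : 0 < r - s := sub_pos.2 hs
  exact (by positivity : r ^ a * (1 / (r - s)) ^ a ≠ 0) (Complex.ofReal_eq_zero.1 h0)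

/-- The moment generating function of the Gamma distribution, on its half-plane of convergence. -/
lemma complexMGF_gammaMeasure {a r : ℝ} (ha : 0 < a) (hr : 0 < r) {z : ℂ} (hz : z.re < r) :
    complexMGF id (gammaMeasure a r) z = (r : ℂ) ^ (a : ℂ) * (1 / (r - z)) ^ (a : ℂ) := by
  have hmgf : AnalyticOnNhd ℂ (complexMGF id (gammaMeasure a r)) {z | z.re < r} :=
    analyticOnNhd_complexMGF.mono fun z hz ↦
      interior_maximal (Iio_subset_integrableExpSet_gammaMeasure ha hr) isOpen_Iio hz
  have hpow : AnalyticOnNhd ℂ (fun z : ℂ ↦ (r : ℂ) ^ (a : ℂ) * (1 / (r - z)) ^ (a : ℂ))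
      {z | z.re < r} := by
    intro z hz
    have hre : 0 < ((r : ℂ) - z).re := by simpa using hz
    have hne : (r : ℂ) - z ≠ 0 := fun h0 ↦ by simp [h0] at hre
    refine analyticAt_const.mul (AnalyticAt.cpow (analyticAt_const.div
      (analyticAt_const.sub analyticAt_id) hne) analyticAt_const ?_)
    refine Complex.mem_slitPlane_iff.2 (Or.inl ?_)
    rw [one_div, Complex.inv_re]
    exact div_pos hre (Complex.normSq_pos.2 hne)
  refine hmgf.eqOn_of_preconnected_of_frequently_eq hpow
    (convex_halfSpace_re_lt r).isPreconnected (z₀ := ((0 : ℝ) : ℂ)) (by simpa using hr) ?_ hz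
  have hreal : ∃ᶠ x : ℝ in 𝓝[≠] 0, complexMGF id (gammaMeasure a r) x =
      (r : ℂ) ^ (a : ℂ) * (1 / (r - x)) ^ (a : ℂ) :=
    (Filter.Eventually.filter_mono nhdsWithin_le_nhds <| (eventually_lt_nhds hr).mono
      fun x hx ↦ complexMGF_gammaMeasure_ofReal ha hr hx).frequently
  refine Filter.Tendsto.frequently ?_ hreal
  exact Complex.continuous_ofReal.continuousAt.continuousWithinAt.tendsto_nhdsWithin
    fun x hx ↦ by simpa using hx

/-- The characteristic function of the Gamma distribution. -/
lemma charFun_gammaMeasure {a r : ℝ} (ha : 0 < a) (hr : 0 < r) (t : ℝ) :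
    charFun (gammaMeasure a r) t = (r : ℂ) ^ (a : ℂ) * (1 / (r - t * Complex.I)) ^ (a : ℂ) := by
  rw [← complexMGF_id_mul_I, complexMGF_gammaMeasure ha hr (by simpa)]

/-- A positive real factor can be pulled out of a complex power. -/
lemma _root_.Complex.ofReal_mul_cpow {x : ℝ} (hx : 0 < x) {z : ℂ} (hz : z ≠ 0) (w : ℂ) :
    ((x : ℂ) * z) ^ w = (x : ℂ) ^ w * z ^ w := by
  have hx' : (x : ℂ) ≠ 0 := Complex.ofReal_ne_zero.2 hx.ne'
  rw [Complex.cpow_def_of_ne_zero (mul_ne_zero hx' hz), Complex.cpow_def_of_ne_zero hx',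
    Complex.cpow_def_of_ne_zero hz, Complex.log_ofReal_mul hx hz, Complex.ofReal_log hx.le,
    add_mul, Complex.exp_add]

/-- The square of a standard Gaussian variable has the characteristic function of the Gamma
distribution with shape and rate `1 / 2`. -/
lemma integral_exp_sq_gaussianReal (t : ℝ) :
    ∫ x : ℝ, Complex.exp (t * (x ^ 2 : ℝ) * Complex.I) ∂(gaussianReal 0 1) =
      ((1 / 2 : ℝ) : ℂ) ^ (1 / 2 : ℂ) *
        (1 / (((1 / 2 : ℝ) : ℂ) - t * Complex.I)) ^ (1 / 2 : ℂ) := by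
  rw [integral_gaussianReal_eq_integral_smul one_ne_zero]
  have h : ∀ x : ℝ, gaussianPDFReal 0 1 x • Complex.exp (t * (x ^ 2 : ℝ) * Complex.I) =
      ((√(2 * Real.pi))⁻¹ : ℝ) * Complex.exp (-(((1 / 2 : ℝ) : ℂ) - t * Complex.I) * x ^ 2) := by
    intro x
    rw [gaussianPDFReal_def, Complex.real_smul]
    push_cast
    rw [mul_assoc, ← Complex.exp_add]
    rw [mul_one, mul_one]
    ring_nf
  simp_rw [h]
  have hb : 1 / (((1 / 2 : ℝ) : ℂ) - t * Complex.I) ≠ 0 := by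
    refine one_div_ne_zero fun h0 ↦ ?_
    simpa using congrArg Complex.re h0
  rw [integral_const_mul, integral_gaussian_complex (by simp), div_eq_mul_one_div (Real.pi : ℂ),
    Complex.ofReal_mul_cpow Real.pi_pos hb, ← mul_assoc]
  congr 1
  rw [show (1 / 2 : ℂ) = ((1 / 2 : ℝ) : ℂ) by push_cast; rfl,
    ← Complex.ofReal_cpow Real.pi_pos.le, ← Complex.ofReal_cpow (by norm_num),
    ← Complex.ofReal_mul, ← Real.sqrt_eq_rpow, ← Real.sqrt_eq_rpow]
  norm_cast
  rw [Real.sqrt_mul zero_le_two]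
  have := (Real.sqrt_pos.2 Real.pi_pos).ne'
  simp
  field_simp

/-- The sum of the squares of `m` independent standard Gaussian variables has the chi-squared
distribution with `m` degrees of freedom. -/
lemma map_sum_sq_pi_gaussianReal {ι : Type*} [Fintype ι] [Nonempty ι] :
    (Measure.pi fun _ : ι ↦ gaussianReal 0 1).map (fun x ↦ ∑ i, x i ^ 2) =
      gammaMeasure (Fintype.card ι / 2 : ℝ) (1 / 2) := by
  have ha : (0 : ℝ) < Fintype.card ι / 2 := by
    have : 0 < Fintype.card ι := Fintype.card_pos
    positivity
  have hm : Measurable fun x : ι → ℝ ↦ ∑ i, x i ^ 2 := by fun_prop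
  have := isProbabilityMeasure_gammaMeasure ha one_half_pos
  have := Measure.isProbabilityMeasure_map (μ := Measure.pi fun _ : ι ↦ gaussianReal 0 1)
    hm.aemeasurable
  refine Measure.ext_of_charFun (funext fun t ↦ ?_)
  rw [charFun_gammaMeasure ha one_half_pos, charFun_apply_real,
    integral_map hm.aemeasurable (by fun_prop)]
  have h : ∀ x : ι → ℝ, Complex.exp (t * (∑ i, x i ^ 2 : ℝ) * Complex.I) =
      ∏ i, Complex.exp (t * (x i ^ 2 : ℝ) * Complex.I) := by
    intro x
    rw [← Complex.exp_sum, Complex.ofReal_sum, Finset.mul_sum, Finset.sum_mul]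
  simp_rw [h]
  rw [integral_fintype_prod_eq_pow (fun x : ℝ ↦ Complex.exp (t * (x ^ 2 : ℝ) * Complex.I)),
    integral_exp_sq_gaussianReal, mul_pow, ← Complex.cpow_nat_mul, ← Complex.cpow_nat_mul]
  push_cast
  rw [mul_one_div]

variable {E : Type*} [NormedAddCommGroup E] [InnerProductSpace ℝ E] [FiniteDimensional ℝ E]
  [MeasurableSpace E] [BorelSpace E]

/-- The squared norm of a standard Gaussian vector has a chi-squared distribution. -/
lemma map_norm_sq_stdGaussian [Nontrivial E] :
    (stdGaussian E).map (fun x ↦ ‖x‖ ^ 2) = gammaMeasure (Module.finrank ℝ E / 2 : ℝ) (1 / 2) := by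
  have : Nonempty (Fin (Module.finrank ℝ E)) := Fin.pos_iff_nonempty.1 Module.finrank_pos
  rw [stdGaussian, Measure.map_map (by fun_prop) (by fun_prop)]
  convert map_sum_sq_pi_gaussianReal (ι := Fin (Module.finrank ℝ E)) using 2
  · ext x
    simp [← (stdOrthonormalBasis ℝ E).sum_sq_inner_right, inner_sum, inner_smul_right,
      OrthonormalBasis.inner_eq_ite]
  · simp

/-- The orthogonal projection of a standard Gaussian vector is a standard Gaussian vector. -/
lemma stdGaussian_map_orthogonalProjectionOnto (K : Submodule ℝ E) :
    (stdGaussian E).map K.orthogonalProjectionOnto = stdGaussian K := by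
  have := Measure.isProbabilityMeasure_map (μ := stdGaussian E)
    (f := K.orthogonalProjectionOnto) (by fun_prop)
  refine Measure.ext_of_charFun (funext fun t ↦ ?_)
  rw [charFun_stdGaussian, charFun_apply, integral_map (by fun_prop) (by fun_prop)]
  have h (x : E) : inner ℝ (K.orthogonalProjectionOnto x) t = inner ℝ x (t : E) := by
    rw [real_inner_comm, K.inner_orthogonalProjectionOnto_eq_of_mem_left, real_inner_comm]
  simp_rw [h]
  rw [← charFun_apply, charFun_stdGaussian, Submodule.coe_norm]

end ProbabilityTheory

/-- Lemma 1 (chi-squared law of the residual sum of squares): in the Gaussian linear model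
`Y = Xα + W` with `W` an `n`-fold product of centered Gaussians of variance `σ²` and design
matrix `X` with `XᵀX` invertible, the residual sum of squares of the ordinary least squares
fit, divided by `σ²`, has the chi-squared distribution with `n − p` degrees of freedom,
i.e. the Gamma distribution with shape `(n−p)/2` and rate `1/2`. -/
theorem rss_div_var_chiSquared
    (n p : ℕ) (hp : 1 ≤ p) (hpn : p < n)
    (X : Matrix (Fin n) (Fin p) ℝ)
    (hX : IsUnit (Xᵀ * X).det)
    (α : Fin p → ℝ) (σ : ℝ) (hσ : 0 < σ)
    (alphaHat : (Fin n → ℝ) → (Fin p → ℝ))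
    (halphaHat : ∀ y, alphaHat y = (Xᵀ * X)⁻¹.mulVec (Xᵀ.mulVec y))
    (RSS : (Fin n → ℝ) → ℝ)
    (hRSS : ∀ y, RSS y = ∑ k, (y k - X.mulVec (alphaHat y) k) ^ 2) :
    Measure.map (fun w : Fin n → ℝ => RSS (X.mulVec α + w) / σ ^ 2)
        (Measure.pi fun _ : Fin n => gaussianReal 0 ⟨σ ^ 2, sq_nonneg σ⟩) =
      gammaMeasure ((n - p : ℝ) / 2) (1 / 2) := by
  set U : Submodule ℝ (EuclideanSpace ℝ (Fin n)) := LinearMap.range (Matrix.toEuclideanLin X)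
    with hU
  have hinj : Function.Injective (Matrix.toEuclideanLin X) := by
    refine (injective_iff_map_eq_zero _).2 fun v hv ↦ ?_
    have h0 : X *ᵥ v.ofLp = 0 := by simpa [Matrix.toLpLin_apply] using hv
    have h1 : (Xᵀ * X) *ᵥ v.ofLp = 0 := by rw [← Matrix.mulVec_mulVec, h0, Matrix.mulVec_zero]
    have h2 : v.ofLp = 0 := by
      rw [← Matrix.one_mulVec v.ofLp, ← Matrix.nonsing_inv_mul _ hX, ← Matrix.mulVec_mulVec, h1,
        Matrix.mulVec_zero]
    ext i
    simp [h2]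
  have hUdim : Module.finrank ℝ U = p := by
    rw [hU, LinearMap.finrank_range_of_inj hinj, finrank_euclideanSpace_fin]
  have hdim : p + Module.finrank ℝ Uᗮ = n := by
    rw [← hUdim, U.finrank_add_finrank_orthogonal, finrank_euclideanSpace_fin]
  have : Nontrivial Uᗮ := Module.nontrivial_of_finrank_pos (R := ℝ) (by omega)
  have hres : ∀ w : Fin n → ℝ, RSS (X *ᵥ α + w) =
      ‖Uᗮ.orthogonalProjectionOnto (WithLp.toLp 2 w)‖ ^ 2 := by
    intro w
    set y := X *ᵥ α + w with hy
    have horth : Xᵀ *ᵥ (y - X *ᵥ alphaHat y) = 0 := by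
      rw [Matrix.mulVec_sub, Matrix.mulVec_mulVec, halphaHat, Matrix.mulVec_mulVec,
        Matrix.mul_nonsing_inv _ hX, Matrix.one_mulVec, sub_self]
    have hproj : WithLp.toLp 2 (y - X *ᵥ alphaHat y) =
        Uᗮ.starProjection (WithLp.toLp 2 w) := by
      symm
      refine Submodule.eq_starProjection_of_mem_orthogonal ?_ ?_
      · rintro _ ⟨v, rfl⟩
        have : (X *ᵥ v.ofLp) ⬝ᵥ (y - X *ᵥ alphaHat y) = 0 := by
          rw [← Matrix.vecMul_transpose, ← Matrix.dotProduct_mulVec, horth, dotProduct_zero]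
        simpa [EuclideanSpace.inner_eq_star_dotProduct, Matrix.toLpLin_apply,
          dotProduct_comm] using this
      · rw [Submodule.orthogonal_orthogonal]
        refine ⟨WithLp.toLp 2 (alphaHat y - α), ?_⟩
        ext i
        simp [Matrix.toLpLin_apply, Matrix.mulVec_sub, hy]
        ring
    rw [hRSS, Submodule.coe_norm, Submodule.coe_orthogonalProjectionOnto_apply, ← hproj,
      EuclideanSpace.real_norm_sq_eq]
    simp
  have hgauss : (gaussianReal 0 1).map (σ * ·) = gaussianReal 0 (.mk (σ ^ 2) (sq_nonneg σ)) := by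
    rw [gaussianReal_map_const_mul]
    simp
  have hscale : (Measure.pi fun _ : Fin n ↦ gaussianReal 0 (.mk (σ ^ 2) (sq_nonneg σ))) =
      (Measure.pi fun _ : Fin n ↦ gaussianReal 0 1).map (fun z ↦ σ • z) := by
    have : SigmaFinite ((gaussianReal 0 1).map (σ * ·)) := by rw [hgauss]; infer_instance
    rw [← hgauss, ← Measure.pi_map_pi (fun _ ↦ by fun_prop)]
    rfl
  have hfun : (fun w : Fin n → ℝ ↦ RSS (X *ᵥ α + w) / σ ^ 2) ∘ (fun z ↦ σ • z) =
      (fun x : Uᗮ ↦ ‖x‖ ^ 2) ∘ Uᗮ.orthogonalProjectionOnto ∘ WithLp.toLp 2 := by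
    ext z
    simp only [Function.comp_apply, hres, WithLp.toLp_smul, map_smul, norm_smul, mul_pow,
      Real.norm_eq_abs, sq_abs]
    field_simp
  have hmeas : Measurable fun w : Fin n → ℝ ↦ RSS (X *ᵥ α + w) / σ ^ 2 := by
    simp_rw [hres]
    fun_prop
  change Measure.map _ (Measure.pi fun _ ↦ gaussianReal 0 (.mk (σ ^ 2) (sq_nonneg σ))) = _
  rw [hscale, Measure.map_map hmeas (by fun_prop), hfun, ← Measure.map_map (by fun_prop)
    (by fun_prop), ← Measure.map_map (by fun_prop) (by fun_prop), map_pi_eq_stdGaussian,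
    stdGaussian_map_orthogonalProjectionOnto, map_norm_sq_stdGaussian]
  congr 2
  rw [eq_sub_iff_add_eq', ← Nat.cast_add, hdim]
end

section
/- Squared norm of an orthogonal projection of a standard Gaussian vector is chi-squared (distributional core of the proof of Lemma 1): Let n ∈ ℕ, let Q be a real symmetric idempotent n×n matrix (Qᵀ = Q, Q² = Q) with trace(Q) = r for a natural number r with 1 ≤ r ≤ n, and let μ be the n-fold product of the standard Gaussian measure on ℝ (mean 0, variance 1). Then the pushforward of μ under the map x ↦ ‖Q x‖² = ∑_{i=1}^n ((Qx)_i)² is the Gamma distribution with shape r/2 and rate 1/2 (the chi-squared distribution with r degrees of freedom). -/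
open MeasureTheory Matrix ProbabilityTheory

namespace MeasureTheory.Measure

/-- Probability measures on `ℝ` whose moment-generating functions coincide, and are finite in a
neighborhood of zero, are equal. -/
theorem ext_of_mgf_id_eq {μ ν : Measure ℝ} [IsProbabilityMeasure μ] [IsProbabilityMeasure ν]
    (h0 : 0 ∈ interior (integrableExpSet id μ)) (h : mgf id μ = mgf id ν) : μ = ν := by
  refine Measure.ext_of_charFun (funext fun t => ?_)
  have := eqOn_complexMGF_of_mgf h (x := (t : ℂ) * Complex.I) (by simpa using h0)
  rwa [complexMGF_id_mul_I, complexMGF_id_mul_I] at this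

end MeasureTheory.Measure

namespace ProbabilityTheory

/-- The moment-generating function of the gamma distribution as an integral over `(0, ∞)`. -/
lemma mgf_id_gammaMeasure_eq_integral {a r : ℝ} (ha : 0 < a) (hr : 0 < r) (t : ℝ) :
    mgf id (gammaMeasure a r) t =
      r ^ a / Real.Gamma a * ∫ x in Set.Ioi (0 : ℝ), x ^ (a - 1) * Real.exp (-((r - t) * x)) := by
  have h1 : mgf id (gammaMeasure a r) t = ∫ x, gammaPDFReal a r x * Real.exp (t * x) := by
    rw [mgf, gammaMeasure, integral_withDensity_eq_integral_toReal_smul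
      (f := gammaPDF a r) (measurable_gammaPDFReal a r).ennreal_ofReal (by simp [gammaPDF])]
    simp [gammaPDF, gammaPDFReal_nonneg ha hr]
  rw [h1, ← setIntegral_eq_integral_of_forall_compl_eq_zero (s := Set.Ici 0),
    integral_Ici_eq_integral_Ioi, ← integral_const_mul]
  · refine setIntegral_congr_fun measurableSet_Ioi fun x hx => ?_
    simp only [gammaPDFReal, if_pos (le_of_lt (Set.mem_Ioi.mp hx))]
    rw [mul_assoc _ (x ^ (a - 1)), mul_assoc, mul_assoc, ← Real.exp_add]
    ring_nf
  · intro x hx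
    simp [gammaPDFReal, Set.mem_Ici.not.mp hx]

/-- The moment-generating function of the gamma distribution below its rate. -/
lemma mgf_id_gammaMeasure {a r t : ℝ} (ha : 0 < a) (hr : 0 < r) (ht : t < r) :
    mgf id (gammaMeasure a r) t = (r / (r - t)) ^ a := by
  have h := sub_pos.mpr ht
  rw [mgf_id_gammaMeasure_eq_integral ha hr, Real.integral_rpow_mul_exp_neg_mul_Ioi ha h,
    Real.div_rpow zero_le_one h.le, Real.div_rpow hr.le h.le, Real.one_rpow]
  field_simp [(Real.Gamma_pos_of_pos ha).ne']

/-- The moment-generating function of the gamma distribution is infinite, hence zero by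
convention, from its rate on. -/
lemma mgf_id_gammaMeasure_of_le {a r t : ℝ} (ha : 0 < a) (hr : 0 < r) (ht : r ≤ t) :
    mgf id (gammaMeasure a r) t = 0 := by
  rw [mgf_id_gammaMeasure_eq_integral ha hr, integral_undef, mul_zero]
  intro h
  refine not_integrableOn_Ioi_rpow (a - 1) (Integrable.mono h ?_ ?_)
  · exact (by fun_prop : Measurable fun x : ℝ => x ^ (a - 1)).aestronglyMeasurable
  · filter_upwards [ae_restrict_mem measurableSet_Ioi] with x hx
    have hx' : 0 < x := hx
    rw [norm_mul, Real.norm_eq_abs (Real.exp _), Real.abs_exp]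
    refine le_mul_of_one_le_right (norm_nonneg _) (Real.one_le_exp ?_)
    nlinarith

lemma zero_mem_interior_integrableExpSet_gammaMeasure {a r : ℝ} (ha : 0 < a) (hr : 0 < r) :
    0 ∈ interior (integrableExpSet id (gammaMeasure a r)) := by
  have := isProbabilityMeasure_gammaMeasure ha hr
  refine mem_interior.mpr ⟨Set.Iio r, fun t (ht : t < r) => ?_, isOpen_Iio, hr⟩
  rw [integrableExpSet, Set.mem_ofPred_eq, ← mgf_pos_iff, mgf_id_gammaMeasure ha hr ht]
  have := sub_pos.mpr ht
  positivity

/-- The moment-generating function of the square of a standard Gaussian variable. It also holds for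
`1 / 2 ≤ t`, when both sides are zero by convention. -/
lemma mgf_sq_gaussianReal (t : ℝ) :
    mgf (fun x => x ^ 2) (gaussianReal 0 1) t = √((1 / 2) / (1 / 2 - t)) := by
  have h (x : ℝ) : gaussianPDFReal 0 1 x • Real.exp (t * x ^ 2) =
      (√(2 * Real.pi))⁻¹ * Real.exp (-(1 / 2 - t) * x ^ 2) := by
    simp only [gaussianPDFReal, smul_eq_mul, NNReal.coe_one, mul_one, sub_zero]
    rw [mul_assoc, ← Real.exp_add]
    ring_nf
  rw [mgf, integral_gaussianReal_eq_integral_smul one_ne_zero]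
  simp_rw [h]
  rw [integral_const_mul, integral_gaussian, ← Real.sqrt_inv, ← Real.sqrt_mul (by positivity)]
  congr 1
  field_simp

/-- A quadratic form in independent standard Gaussian variables, with coefficients in `{0, 1}` of
sum `r`, has the moment-generating function of a chi-squared variable. -/
lemma mgf_sum_mul_sq_pi_gaussianReal {ι : Type*} [Fintype ι] {c : ι → ℝ}
    (hc : ∀ i, c i = 0 ∨ c i = 1) {r : ℕ} (hr : ∑ i, c i = r) (t : ℝ) :
    mgf (fun x : ι → ℝ => ∑ i, c i * x i ^ 2) (Measure.pi fun _ => gaussianReal 0 1) t =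
      √((1 / 2) / (1 / 2 - t)) ^ r := by
  have h (i : ι) : ∫ x, Real.exp (t * (c i * x ^ 2)) ∂gaussianReal 0 1 =
      if c i = 1 then √((1 / 2) / (1 / 2 - t)) else 1 := by
    rcases hc i with hi | hi
    · simp [hi]
    · simpa [hi, mgf] using mgf_sq_gaussianReal t
  have hcard : ({i | c i = 1} : Finset ι).card = r := by
    rw [← Nat.cast_inj (R := ℝ), ← hr, Finset.card_filter, Nat.cast_sum]
    refine Finset.sum_congr rfl fun i _ => ?_
    rcases hc i with hi | hi <;> simp [hi]
  simp only [mgf, Finset.mul_sum, Real.exp_sum]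
  rw [integral_fintype_prod_eq_prod (f := fun i x => Real.exp (t * (c i * x ^ 2))),
    Finset.prod_congr rfl fun i _ => h i, Finset.prod_ite, Finset.prod_const, Finset.prod_const_one,
    mul_one, hcard]

/-- The law of a quadratic form in independent standard Gaussian variables, with coefficients in
`{0, 1}` of positive sum `r`, is the chi-squared distribution with `r` degrees of freedom. -/
lemma map_sum_mul_sq_pi_gaussianReal {ι : Type*} [Fintype ι] {c : ι → ℝ}
    (hc : ∀ i, c i = 0 ∨ c i = 1) {r : ℕ} (hr0 : r ≠ 0) (hr : ∑ i, c i = r) :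
    (Measure.pi fun _ => gaussianReal 0 1).map (fun x : ι → ℝ => ∑ i, c i * x i ^ 2) =
      gammaMeasure ((r : ℝ) / 2) (1 / 2) := by
  have hpos : (0 : ℝ) < r / 2 := by positivity
  have hmeas : Measurable fun x : ι → ℝ => ∑ i, c i * x i ^ 2 := by fun_prop
  have := isProbabilityMeasure_gammaMeasure hpos one_half_pos
  have := Measure.isProbabilityMeasure_map
    (μ := Measure.pi fun _ : ι => gaussianReal 0 1) hmeas.aemeasurable
  refine (Measure.ext_of_mgf_id_eq
    (zero_mem_interior_integrableExpSet_gammaMeasure hpos one_half_pos) (funext fun t => ?_)).symm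
  rw [mgf_id_map hmeas.aemeasurable, mgf_sum_mul_sq_pi_gaussianReal hc hr]
  rcases lt_or_ge t (1 / 2) with ht | ht
  · have h : (0 : ℝ) ≤ 1 / 2 / (1 / 2 - t) := div_nonneg one_half_pos.le (sub_nonneg.mpr ht.le)
    rw [mgf_id_gammaMeasure hpos one_half_pos ht, Real.sqrt_eq_rpow, ← Real.rpow_mul_natCast h]
    ring_nf
  · rw [mgf_id_gammaMeasure_of_le hpos one_half_pos ht, Real.sqrt_eq_zero_of_nonpos
      (div_nonpos_of_nonneg_of_nonpos one_half_pos.le (sub_nonpos.mpr ht)), zero_pow hr0]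

end ProbabilityTheory

namespace Matrix

/-- The eigenvalues of a symmetric idempotent matrix are `0` and `1`. -/
lemma IsHermitian.eigenvalues_eq_zero_or_one {ι : Type*} [Fintype ι] [DecidableEq ι]
    {Q : Matrix ι ι ℝ} (hQ : Q.IsHermitian) (hQidem : Q * Q = Q) (i : ι) :
    hQ.eigenvalues i = 0 ∨ hQ.eigenvalues i = 1 := by
  have h := hQ.mulVec_eigenvectorBasis i
  have h2 := congrArg (Q *ᵥ ·) h
  simp only [mulVec_mulVec, hQidem, mulVec_smul] at h2
  rw [h, smul_smul] at h2
  have hv : (⇑(hQ.eigenvectorBasis i) : ι → ℝ) ≠ 0 := fun h0 =>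
    hQ.eigenvectorBasis.orthonormal.ne_zero i (PiLp.ext fun j => congrFun h0 j)
  have := smul_left_injective ℝ hv h2
  grind

/-- Multiplication by a symmetric matrix in terms of coordinates in its eigenvector basis. -/
lemma IsHermitian.sum_sq_mulVec_sum_eigenvectorBasis {ι : Type*} [Fintype ι] [DecidableEq ι]
    {Q : Matrix ι ι ℝ} (hQ : Q.IsHermitian) (x : ι → ℝ) :
    ∑ i, (Q *ᵥ (⇑(∑ j, x j • hQ.eigenvectorBasis j) : ι → ℝ)) i ^ 2 =
      ∑ i, hQ.eigenvalues i ^ 2 * x i ^ 2 := by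
  set b := hQ.eigenvectorBasis
  have h : Q *ᵥ (⇑(∑ j, x j • b j) : ι → ℝ) =
      ⇑(∑ j, (hQ.eigenvalues j * x j) • b j) := by
    simp only [WithLp.ofLp_sum, WithLp.ofLp_smul, mulVec_sum, mulVec_smul]
    refine Finset.sum_congr rfl fun j _ => ?_
    rw [hQ.mulVec_eigenvectorBasis, smul_smul, mul_comm]
  rw [h, ← EuclideanSpace.real_norm_sq_eq, ← real_inner_self_eq_norm_sq, b.orthonormal.inner_sum]
  simp [sq, mul_mul_mul_comm]

end Matrix

/-- Squared norm of an orthogonal projection of a standard Gaussian vector is chi-squared: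
if `Q` is a real symmetric idempotent `n×n` matrix with trace `r` (`1 ≤ r ≤ n`) and `μ` is the
`n`-fold product of the standard Gaussian measure, then the pushforward of `μ` under
`x ↦ ‖Qx‖² = ∑ i, ((Qx)_i)²` is the Gamma distribution with shape `r/2` and rate `1/2`
(the chi-squared distribution with `r` degrees of freedom). -/
theorem sq_norm_proj_gaussian_chiSquared
    (n : ℕ) (Q : Matrix (Fin n) (Fin n) ℝ)
    (hQsymm : Qᵀ = Q) (hQidem : Q * Q = Q)
    (r : ℕ) (hr : 1 ≤ r) (hrn : r ≤ n)
    (htrace : Q.trace = (r : ℝ)) :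
    Measure.map (fun x : Fin n → ℝ => ∑ i, (Q.mulVec x i) ^ 2)
        (Measure.pi fun _ : Fin n => gaussianReal 0 1) =
      gammaMeasure ((r : ℝ) / 2) (1 / 2) := by
  have hQ : Q.IsHermitian := by rw [IsHermitian, conjTranspose_eq_transpose_of_trivial, hQsymm]
  have hev := hQ.eigenvalues_eq_zero_or_one hQidem
  let g : EuclideanSpace ℝ (Fin n) → ℝ := fun y => ∑ i, (Q.mulVec y i) ^ 2
  have hg : Measurable g := by
    refine Continuous.measurable ?_
    simp only [g, mulVec, dotProduct]
    fun_prop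
  calc Measure.map (g ∘ WithLp.toLp 2) (Measure.pi fun _ : Fin n => gaussianReal 0 1)
    _ = Measure.map (g ∘ fun x : Fin n → ℝ => ∑ j, x j • hQ.eigenvectorBasis j)
          (Measure.pi fun _ : Fin n => gaussianReal 0 1) := by
        rw [← Measure.map_map hg (by fun_prop), map_pi_eq_stdGaussian,
          stdGaussian_eq_map_pi_orthonormalBasis hQ.eigenvectorBasis,
          Measure.map_map hg (by fun_prop)]
    _ = Measure.map (fun x : Fin n → ℝ => ∑ i, hQ.eigenvalues i * x i ^ 2)
          (Measure.pi fun _ : Fin n => gaussianReal 0 1) := by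
        congr 1
        ext x
        refine (hQ.sum_sq_mulVec_sum_eigenvectorBasis x).trans (Finset.sum_congr rfl fun i _ => ?_)
        rcases hev i with h | h <;> simp [h]
    _ = gammaMeasure ((r : ℝ) / 2) (1 / 2) := by
        refine map_sum_mul_sq_pi_gaussianReal hev (Nat.one_le_iff_ne_zero.mp hr) ?_
        rw [← htrace, hQ.trace_eq_sum_eigenvalues]
        rfl
end

section
/- Deviation bound for the difference of two chi-squared-distributed residuals (core probabilistic estimate in the proof of Theorem 2): Let (Ω, ℙ) be a probability space, σ > 0, and let a, b be natural numbers with a, b ≥ 1. Let U, V : Ω → ℝ be random variables (with arbitrary joint dependence) such that U/σ² has the chi-squared distribution with a degrees of freedom and V/σ² has the chi-squared distribution with b degrees of freedom. For τ ∈ ℝ set τ' = (τ − |a − b| σ²) / (2σ²). Then ℙ(|U − V| > τ) ≤ 2 − F_a(τ' + a) + F_a(−τ' + a) − F_b(τ' + b) + F_b(−τ' + b), where F_k is the cumulative distribution function of the chi-squared distribution with k degrees of freedom. In particular, if τ is chosen so that the right-hand side equals ε, the probability that the two residual sums of squares differ by more than τ is at most ε. -/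
open MeasureTheory ProbabilityTheory

/-- The two tails of a real random variable with law `μ`, expressed through the distribution
function of `μ`. -/
lemma measureReal_lt_abs_sub_le {Ω : Type*} [MeasurableSpace Ω] (P : Measure Ω)
    [IsProbabilityMeasure P] {X : Ω → ℝ} (hX : Measurable X) {μ : Measure ℝ}
    (hμ : Measure.map X P = μ) (c t : ℝ) :
    P.real {ω | t < |X ω - c|} ≤ 1 - μ.real (Set.Iic (t + c)) + μ.real (Set.Iic (-t + c)) := by
  subst hμ
  rw [map_measureReal_apply hX measurableSet_Iic, map_measureReal_apply hX measurableSet_Iic,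
    ← probReal_compl_eq_one_sub (hX measurableSet_Iic)]
  refine (measureReal_mono fun ω hω ↦ ?_).trans (measureReal_union_le _ _)
  rcases lt_abs.1 (show t < |X ω - c| from hω) with h | h
  · left
    simp only [Set.mem_compl_iff, Set.mem_preimage, Set.mem_Iic, not_le]
    linarith
  · right
    simp only [Set.mem_preimage, Set.mem_Iic]
    linarith

/-- Deviation bound for the difference of two chi-squared-distributed residuals (core
probabilistic estimate in the proof of Theorem 2): if `U/σ²` is chi-squared with `a` degrees
of freedom and `V/σ²` is chi-squared with `b` degrees of freedom (arbitrary joint dependence),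
then for `τ' = (τ − |a − b|σ²)/(2σ²)`,
`Pr(|U − V| > τ) ≤ 2 − F_a(τ'+a) + F_a(−τ'+a) − F_b(τ'+b) + F_b(−τ'+b)`. -/
theorem chiSquared_difference_deviation_bound
    {Ω : Type*} [MeasurableSpace Ω] (Pr : Measure Ω) [IsProbabilityMeasure Pr]
    (σ : ℝ) (hσ : 0 < σ)
    (a b : ℕ) (ha : 1 ≤ a) (hb : 1 ≤ b)
    (U V : Ω → ℝ) (hU_meas : Measurable U) (hV_meas : Measurable V)
    (hU : Measure.map (fun ω => U ω / σ ^ 2) Pr = gammaMeasure ((a : ℝ) / 2) (1 / 2))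
    (hV : Measure.map (fun ω => V ω / σ ^ 2) Pr = gammaMeasure ((b : ℝ) / 2) (1 / 2))
    (F : ℕ → ℝ → ℝ)
    (hF : ∀ (k : ℕ) (x : ℝ), F k x = (gammaMeasure ((k : ℝ) / 2) (1 / 2) (Set.Iic x)).toReal)
    (τ τ' : ℝ)
    (hτ' : τ' = (τ - |(a : ℝ) - (b : ℝ)| * σ ^ 2) / (2 * σ ^ 2)) :
    (Pr {ω | τ < |U ω - V ω|}).toReal ≤
      2 - F a (τ' + a) + F a (-τ' + a) - F b (τ' + b) + F b (-τ' + b) := by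
  have hσ2 : 0 < σ ^ 2 := by positivity
  have hsub : {ω | τ < |U ω - V ω|} ⊆
      {ω | τ' < |U ω / σ ^ 2 - a|} ∪ {ω | τ' < |V ω / σ ^ 2 - b|} := by
    intro ω hω
    by_contra hcon
    simp only [Set.mem_union, Set.mem_ofPred_eq, not_or, not_lt] at hcon hω
    obtain ⟨h1, h2⟩ := hcon
    have hdecomp : U ω - V ω =
        ((U ω / σ ^ 2 - a) - (V ω / σ ^ 2 - b) + ((a : ℝ) - b)) * σ ^ 2 := by
      field_simp
      ring
    have habs : |U ω - V ω| ≤ (τ' + τ' + |(a : ℝ) - b|) * σ ^ 2 := by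
      rw [hdecomp, abs_mul, abs_of_pos hσ2]
      gcongr
      exact (abs_add_le _ _).trans (by gcongr; exact (abs_sub _ _).trans (add_le_add h1 h2))
    have hτ : (τ' + τ' + |(a : ℝ) - b|) * σ ^ 2 = τ := by
      rw [hτ']
      field_simp
      ring
    linarith
  have hle := (measureReal_mono (μ := Pr) hsub).trans (measureReal_union_le _ _)
  have hUtail := measureReal_lt_abs_sub_le Pr (hU_meas.div_const _) hU a τ'
  have hVtail := measureReal_lt_abs_sub_le Pr (hV_meas.div_const _) hV b τ'
  simp only [hF]
  simp only [measureReal_def] at hle hUtail hVtail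
  linarith
end
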